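/- Let X ⊂ P^4 be an irreducible hypersurface covered by the lines of a family of dimension 2 such that the Fano scheme Σ is generically reduced. Let Σ_1 be an irreducible 2-dimensional component of Σ with μ_1 > 1, let r ∈ Σ_1 be general, and set σ_1(r) = { r' ∈ Σ_1 : r ∩ r' ≠ ∅ }. Then r ∉ σ_1(r); equivalently, r is not a limit of lines of Σ_1 meeting r. -/

import Mathlib

open MvPolynomial

noncomputable section

namespace PaperLines

variable (K : Type) [Field K]

/-- Projective `N`-space over `K`, as the projectivization of `K^{N+1}`. -/
abbrev PP (N : ℕ) := Projectivization K (Fin (N + 1) → K)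

/-- The zero locus in `ℙ^N` of a (homogeneous) polynomial. -/
def projZeros {N : ℕ} (F : MvPolynomial (Fin (N + 1)) K) : Set (PP K N) :=
  {x | ∀ v ∈ x.submodule, eval v F = 0}

/-- The projective linear subspace associated to a linear subspace `W ⊆ K^{N+1}`. -/
def projLinear {N : ℕ} (W : Submodule K (Fin (N + 1) → K)) : Set (PP K N) :=
  {x | x.submodule ≤ W}

/-- The Grassmannian of `k`-dimensional linear subspaces of `K^{N+1}`
(`k = 2` gives the lines of `ℙ^N`, `k = 3` the planes). -/
def Grass (k N : ℕ) := {W : Submodule K (Fin (N + 1) → K) // Module.finrank K W = k}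

/-- The set of lines contained in the hypersurface `{F = 0} ⊆ ℙ^N`. -/
def fanoSet {N : ℕ} (F : MvPolynomial (Fin (N + 1)) K) : Set (Grass K 2 N) :=
  {W | projLinear K W.1 ⊆ projZeros K F}

/-- `X = {F = 0}` is covered by lines. -/
def CoveredByLines {N : ℕ} (F : MvPolynomial (Fin (N + 1)) K) : Prop :=
  ∀ x ∈ projZeros K F, ∃ W ∈ fanoSet K F, x ∈ projLinear K W.1

/-- The ideal of polynomials vanishing on a subset of affine space `K^σ`. -/
def affVanishing {σ : Type} (S : Set (σ → K)) : Ideal (MvPolynomial σ K) where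
  carrier := {f | ∀ v ∈ S, eval v f = 0}
  add_mem' := by
    intro a b ha hb v hv
    simp only [map_add, ha v hv, hb v hv, add_zero]
  zero_mem' := by intro v hv; simp
  smul_mem' := by
    intro c a ha v hv
    simp only [smul_eq_mul, map_mul, ha v hv, mul_zero]

/-- The dimension of a subset of affine space `K^σ`, as the Krull dimension of its
coordinate ring (this only depends on the Zariski closure). -/
def affDim {σ : Type} (S : Set (σ → K)) : WithBot ℕ∞ :=
  ringKrullDim (MvPolynomial σ K ⧸ affVanishing K S)

/-- The affine cone over a subset of `ℙ^N`. -/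
def projCone {N : ℕ} (S : Set (PP K N)) : Set (Fin (N + 1) → K) :=
  {v | ∃ x ∈ S, v ∈ x.submodule}

/-- A subset of `ℙ^N` has (projective) dimension `d`:  its affine cone has dimension `d+1`. -/
def HasProjDim {N : ℕ} (S : Set (PP K N)) (d : ℕ) : Prop :=
  affDim K (projCone K S) = ((d + 1 : ℕ) : WithBot ℕ∞)

/-- A subset of `ℙ^N` has (projective) dimension at most `d`. -/
def ProjDimLE {N : ℕ} (S : Set (PP K N)) (d : ℕ) : Prop :=
  affDim K (projCone K S) ≤ ((d + 1 : ℕ) : WithBot ℕ∞)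

/-- A subset of `ℙ^N` has (projective) dimension at least `d`. -/
def ProjDimGE {N : ℕ} (S : Set (PP K N)) (d : ℕ) : Prop :=
  ((d + 1 : ℕ) : WithBot ℕ∞) ≤ affDim K (projCone K S)

/-- A `k`-tuple of vectors (a "frame") all lying in the subspace `W`. -/
def frameMem {k N : ℕ} (p : Fin k × Fin (N + 1) → K) (W : Submodule K (Fin (N + 1) → K)) : Prop :=
  ∀ i : Fin k, (fun j => p (i, j)) ∈ W

/-- The "Stiefel cone" over a family of `k`-planes: all `k`-tuples of vectors lying in some
member of the family.  Over a `d`-dimensional family it has dimension `d + k²`. -/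
def frameCone (k N : ℕ) (S : Set (Grass K k N)) : Set (Fin k × Fin (N + 1) → K) :=
  {p | ∃ W ∈ S, frameMem K p W.1}

/-- A family of `k`-planes has dimension `d` (computed via its Stiefel cone). -/
def HasGrDim {k N : ℕ} (S : Set (Grass K k N)) (d : ℕ) : Prop :=
  affDim K (frameCone K k N S) = ((d + k * k : ℕ) : WithBot ℕ∞)

/-- A family of `k`-planes has dimension at least `d`. -/
def GrDimGE {k N : ℕ} (S : Set (Grass K k N)) (d : ℕ) : Prop :=
  ((d + k * k : ℕ) : WithBot ℕ∞) ≤ affDim K (frameCone K k N S)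

/-- Zariski-closed subsets of the Grassmannian: common zero sets of families of polynomials
in frame coordinates (vanishing being required for every frame). -/
def GrClosed {k N : ℕ} (S : Set (Grass K k N)) : Prop :=
  ∃ 𝒢 : Set (MvPolynomial (Fin k × Fin (N + 1)) K),
    S = {W | ∀ G ∈ 𝒢, ∀ p, frameMem K p W.1 → eval p G = 0}

/-- The Zariski closure of a family of `k`-planes in the Grassmannian. -/
def grClosure {k N : ℕ} (S : Set (Grass K k N)) : Set (Grass K k N) :=
  ⋂₀ {C | GrClosed K C ∧ S ⊆ C}

/-- Irreducibility of a family of `k`-planes. -/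
def GrIrred {k N : ℕ} (S : Set (Grass K k N)) : Prop :=
  S.Nonempty ∧ ∀ C₁ C₂, GrClosed K C₁ → GrClosed K C₂ → S ⊆ C₁ ∪ C₂ → S ⊆ C₁ ∨ S ⊆ C₂

/-- `S` is an irreducible component of `T` (a maximal irreducible subset). -/
def IsGrComponentOf {k N : ℕ} (S T : Set (Grass K k N)) : Prop :=
  S ⊆ T ∧ GrIrred K S ∧ ∀ S', S ⊆ S' → S' ⊆ T → GrIrred K S' → S' = S

/-- A property `P` holds for a general member of the family `S` of `k`-planes:
it holds on a nonempty principal open subset of `S`. -/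
def GenerallyOnGr {k N : ℕ} (S : Set (Grass K k N)) (P : Grass K k N → Prop) : Prop :=
  ∃ G : MvPolynomial (Fin k × Fin (N + 1)) K,
    (∃ W ∈ S, ∃ p, frameMem K p W.1 ∧ eval p G ≠ 0) ∧
    ∀ W ∈ S, (∃ p, frameMem K p W.1 ∧ eval p G ≠ 0) → P W

/-- A property `P` holds for a general pair of members of the families `S`, `T`. -/
def GenerallyOnGr2 {k N : ℕ} (S T : Set (Grass K k N))
    (P : Grass K k N → Grass K k N → Prop) : Prop :=
  ∃ G : MvPolynomial ((Fin k × Fin (N + 1)) ⊕ (Fin k × Fin (N + 1))) K,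
    (∃ W ∈ S, ∃ W' ∈ T, ∃ p q, frameMem K p W.1 ∧ frameMem K q W'.1 ∧
      eval (Sum.elim p q) G ≠ 0) ∧
    ∀ W ∈ S, ∀ W' ∈ T, (∃ p q, frameMem K p W.1 ∧ frameMem K q W'.1 ∧
      eval (Sum.elim p q) G ≠ 0) → P W W'

/-- A property `P` holds for a general point of the subset `S ⊆ ℙ^N`. -/
def GenerallyOn {N : ℕ} (S : Set (PP K N)) (P : PP K N → Prop) : Prop :=
  ∃ G : MvPolynomial (Fin (N + 1)) K,
    (∃ x ∈ S, ∃ v ∈ x.submodule, eval v G ≠ 0) ∧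
    ∀ x ∈ S, (∃ v ∈ x.submodule, eval v G ≠ 0) → P x

/-- A property `P` holds for a general hyperplane (given by a nonzero linear form `L`). -/
def GenerallyOnHyp {N : ℕ} (P : (Fin (N + 1) → K) → Prop) : Prop :=
  ∃ G : MvPolynomial (Fin (N + 1)) K,
    (∃ L : Fin (N + 1) → K, L ≠ 0 ∧ eval L G ≠ 0) ∧
    ∀ L : Fin (N + 1) → K, L ≠ 0 → eval L G ≠ 0 → P L

/-- Through a general point of `X = {F = 0}` there pass exactly `μ` lines of the family `Lf`. -/
def HasMuOn {N : ℕ} (Lf : Set (Grass K 2 N)) (F : MvPolynomial (Fin (N + 1)) K)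
    (μ : ℕ) : Prop :=
  GenerallyOn K (projZeros K F) (fun x => {W | W ∈ Lf ∧ x ∈ projLinear K W.1}.ncard = μ)

/-- Through a general point of `X = {F = 0}` there pass exactly `μ` lines contained in `X`. -/
def HasMu {N : ℕ} (F : MvPolynomial (Fin (N + 1)) K) (μ : ℕ) : Prop :=
  HasMuOn K (fanoSet K F) F μ

/-- The ideal of the Fano scheme of lines on `{F = 0}`, in Stiefel (frame) coordinates:
it is generated by the coefficients (in `s,t`) of `F(s·v + t·w)`. -/
def fanoIdeal {N : ℕ} (F : MvPolynomial (Fin (N + 1)) K) :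
    Ideal (MvPolynomial (Fin 2 × Fin (N + 1)) K) :=
  Ideal.span {g | ∃ d : Fin 2 →₀ ℕ, g = coeff d
    (aeval (fun j : Fin (N + 1) =>
      (X 0 : MvPolynomial (Fin 2) (MvPolynomial (Fin 2 × Fin (N + 1)) K)) * C (X (0, j)) +
        X 1 * C (X (1, j))) F)}

/-- An ideal is generically reduced: at every minimal prime `p` over `I`, the localization
of `R/I` is reduced, i.e. `I_p = p_p`. -/
def GenericallyReducedIdeal {R : Type} [CommRing R] (I : Ideal R) : Prop :=
  ∀ p ∈ I.minimalPrimes, ∀ x ∈ p, ∃ s, s ∉ p ∧ s * x ∈ I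

/-- The Fano scheme of lines on `{F = 0}` is generically reduced. -/
def FanoGenerallyReduced {N : ℕ} (F : MvPolynomial (Fin (N + 1)) K) : Prop :=
  GenericallyReducedIdeal (fanoIdeal K F)

/-- The prime (in frame coordinates) corresponding to a point `r` of the Grassmannian of lines. -/
def framePrime {N : ℕ} (r : Grass K 2 N) : Ideal (MvPolynomial (Fin 2 × Fin (N + 1)) K) :=
  affVanishing K (frameCone K 2 N {r})

/-- The Fano scheme of lines on `{F = 0}` is reduced at the line `r`. -/
def FanoReducedAt {N : ℕ} (F : MvPolynomial (Fin (N + 1)) K) (r : Grass K 2 N) : Prop :=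
  ∀ x ∈ framePrime K r, ∃ s, s ∉ framePrime K r ∧ s * x ∈ fanoIdeal K F

/-- The Fano scheme is reduced at the generic point of the component `Fam`. -/
def ComponentGenerallyReduced {N : ℕ} (F : MvPolynomial (Fin (N + 1)) K)
    (Fam : Set (Grass K 2 N)) : Prop :=
  ∀ x ∈ affVanishing K (frameCone K 2 N Fam),
    ∃ s, s ∉ affVanishing K (frameCone K 2 N Fam) ∧ s * x ∈ fanoIdeal K F

/-- The gradient vector of `F` at `v`. -/
def gradVec {N : ℕ} (F : MvPolynomial (Fin (N + 1)) K) (v : Fin (N + 1) → K) :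
    Fin (N + 1) → K :=
  fun i => eval v (pderiv i F)

/-- The singular locus of the hypersurface `{F = 0}`. -/
def singLocus {N : ℕ} (F : MvPolynomial (Fin (N + 1)) K) : Set (PP K N) :=
  {x | x ∈ projZeros K F ∧ ∀ v ∈ x.submodule, gradVec K F v = 0}

/-- `x` is a smooth point of the hypersurface `{F = 0}`. -/
def SmoothAt {N : ℕ} (F : MvPolynomial (Fin (N + 1)) K) (x : PP K N) : Prop :=
  x ∈ projZeros K F ∧ x ∉ singLocus K F

/-- The embedded tangent hyperplane to `{F = 0}` at a (smooth) point `x`. -/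
def tangentHyp {N : ℕ} (F : MvPolynomial (Fin (N + 1)) K) (x : PP K N) : Set (PP K N) :=
  {y | ∀ v ∈ x.submodule, ∀ w ∈ y.submodule, ∑ i, gradVec K F v i * w i = 0}

/-- The hyperplane of `ℙ^N` with coefficient vector `L`. -/
def hypSet {N : ℕ} (L : Fin (N + 1) → K) : Set (PP K N) :=
  {x | ∀ v ∈ x.submodule, ∑ i, L i * v i = 0}

/-- A quadric surface in `ℙ⁴`: a two-dimensional intersection of a quadric and a hyperplane. -/
def IsQuadricSurface (Q : Set (PP K 4)) : Prop :=
  ∃ (q : MvPolynomial (Fin 5) K) (W : Submodule K (Fin 5 → K)),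
    q.IsHomogeneous 2 ∧ Module.finrank K W = 4 ∧
    Q = projZeros K q ∩ projLinear K W ∧ HasProjDim K Q 2

/-- `X = {F = 0}` is (birationally) ruled by quadrics over a curve: it is covered by a
one-dimensional family of quadric surfaces with exactly one member through a general point. -/
def QuadricBundle (F : MvPolynomial (Fin 5) K) : Prop :=
  ∃ 𝒬 : Set (Set (PP K 4)),
    (∀ Q ∈ 𝒬, IsQuadricSurface K Q ∧ Q ⊆ projZeros K F) ∧
    GenerallyOn K (projZeros K F) (fun x => ∃! Q, Q ∈ 𝒬 ∧ x ∈ Q)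

/-- The degree of a `d`-dimensional subset `S ⊆ ℙ^N`: the largest finite number of points in
which a linear subspace of complementary dimension meets `S`. -/
def projDegree {N : ℕ} (S : Set (PP K N)) (d : ℕ) : ℕ :=
  sSup {m | ∃ W : Submodule K (Fin (N + 1) → K), Module.finrank K W = N + 1 - d ∧
    (S ∩ projLinear K W).Finite ∧ (S ∩ projLinear K W).ncard = m}

/-- Zariski-closed subsets of `ℙ^N`. -/
def ProjClosed {N : ℕ} (S : Set (PP K N)) : Prop :=
  ∃ 𝒮 : Set (MvPolynomial (Fin (N + 1)) K),
    S = {x | ∀ f ∈ 𝒮, ∀ v ∈ x.submodule, eval v f = 0}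

/-- The Zariski closure of a subset of `ℙ^N`. -/
def projClosure {N : ℕ} (S : Set (PP K N)) : Set (PP K N) :=
  ⋂₀ {C | ProjClosed K C ∧ S ⊆ C}

/-- The image of a subset of `ℙ^a` under the rational map `ℙ^a ⤏ ℙ^b` induced by a
linear map `T : K^{a+1} → K^{b+1}`. -/
def projImage {a b : ℕ} (T : (Fin (a + 1) → K) →ₗ[K] (Fin (b + 1) → K))
    (Y : Set (PP K a)) : Set (PP K b) :=
  {x | ∃ y ∈ Y, ∃ v ∈ y.submodule, ∃ h : T v ≠ 0, x = Projectivization.mk K (T v) h}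

/-- `Xs ⊆ ℙ^b` is a (linear) projection of `Y ⊆ ℙ^a`. -/
def IsProjectionOf {a b : ℕ} (Xs : Set (PP K b)) (Y : Set (PP K a)) : Prop :=
  ∃ T : (Fin (a + 1) → K) →ₗ[K] (Fin (b + 1) → K),
    Xs = projClosure K (projImage K T Y)

/-- `Y ⊆ ℙ⁵` is a three-dimensional complete intersection of two quadric hypersurfaces. -/
def IsQuadricIntersection5 (Y : Set (PP K 5)) : Prop :=
  ∃ q₁ q₂ : MvPolynomial (Fin 6) K, q₁.IsHomogeneous 2 ∧ q₂.IsHomogeneous 2 ∧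
    Y = projZeros K q₁ ∩ projZeros K q₂ ∧ HasProjDim K Y 3

def idx55 : Fin 25 ≃ Fin 5 × Fin 5 :=
  (finCongr (by norm_num : 25 = 5 * 5)).trans finProdFinEquiv.symm

/-- The Plücker coordinate vector of the pair `(v, w)`. -/
def pluckOf (v w : Fin 5 → K) : Fin 25 → K :=
  fun kk => v (idx55 kk).1 * w (idx55 kk).2 - v (idx55 kk).2 * w (idx55 kk).1

/-- The Grassmannian `G(1,4)` of lines of `ℙ⁴` in its Plücker embedding. -/
def grassPlucker : Set (PP K 24) :=
  {x | ∃ v w : Fin 5 → K, ∃ h : pluckOf K v w ≠ 0,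
    x = Projectivization.mk K (pluckOf K v w) h}

/-- `Y` is a section of the Plücker-embedded `G(1,4)` by a linear `ℙ⁶`. -/
def IsGrassP6Section (Y : Set (PP K 24)) : Prop :=
  ∃ W : Submodule K (Fin 25 → K), Module.finrank K W = 7 ∧
    Y = grassPlucker K ∩ projLinear K W

def idx33 : Fin 9 ≃ Fin 3 × Fin 3 :=
  (finCongr (by norm_num : 9 = 3 * 3)).trans finProdFinEquiv.symm

def segre22Vec (a b : Fin 3 → K) : Fin 9 → K := fun kk => a (idx33 kk).1 * b (idx33 kk).2

/-- The Segre embedding of `ℙ² × ℙ²` in `ℙ⁸`. -/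
def segreP2P2 : Set (PP K 8) :=
  {x | ∃ a b : Fin 3 → K, ∃ h : segre22Vec K a b ≠ 0,
    x = Projectivization.mk K (segre22Vec K a b) h}

def idx222 : Fin 8 ≃ Fin 2 × Fin 2 × Fin 2 :=
  (finCongr (by norm_num : 8 = 2 * 4)).trans (finProdFinEquiv.symm.trans
    (Equiv.prodCongr (Equiv.refl _)
      ((finCongr (by norm_num : 4 = 2 * 2)).trans finProdFinEquiv.symm)))

def segre111Vec (a b c : Fin 2 → K) : Fin 8 → K :=
  fun kk => a (idx222 kk).1 * b (idx222 kk).2.1 * c (idx222 kk).2.2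

/-- The Segre embedding of `ℙ¹ × ℙ¹ × ℙ¹` in `ℙ⁷`. -/
def segreP1P1P1 : Set (PP K 7) :=
  {x | ∃ a b c : Fin 2 → K, ∃ h : segre111Vec K a b c ≠ 0,
    x = Projectivization.mk K (segre111Vec K a b c) h}

def evalVec {m l : ℕ} (f : Fin l → MvPolynomial (Fin m) K) (v : Fin m → K) : Fin l → K :=
  fun j => eval v (f j)

/-- Two projective sets are birational: there are rational maps, given by homogeneous
polynomials, defined and mutually inverse on general points. -/
def AreBirational {a b : ℕ} (C : Set (PP K a)) (D : Set (PP K b)) : Prop :=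
  ∃ (f : Fin (b + 1) → MvPolynomial (Fin (a + 1)) K)
    (g : Fin (a + 1) → MvPolynomial (Fin (b + 1)) K) (d e : ℕ),
    (∀ j, (f j).IsHomogeneous d) ∧ (∀ i, (g i).IsHomogeneous e) ∧
    GenerallyOn K C (fun x => ∃ v ∈ x.submodule, ∃ h : evalVec K f v ≠ 0,
      Projectivization.mk K (evalVec K f v) h ∈ D ∧
      ∃ h2 : evalVec K g (evalVec K f v) ≠ 0,
        Projectivization.mk K (evalVec K g (evalVec K f v)) h2 = x) ∧
    GenerallyOn K D (fun y => ∃ w ∈ y.submodule, ∃ h : evalVec K g w ≠ 0,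
      Projectivization.mk K (evalVec K g w) h ∈ C ∧
      ∃ h2 : evalVec K f (evalVec K g w) ≠ 0,
        Projectivization.mk K (evalVec K f (evalVec K g w)) h2 = y)

/-- A smooth plane cubic curve (its equation). -/
def IsSmoothPlaneCubic (q : MvPolynomial (Fin 3) K) : Prop :=
  q.IsHomogeneous 3 ∧
    ∀ v : Fin 3 → K, v ≠ 0 → eval v q = 0 → (fun i => eval v (pderiv i q)) ≠ 0

/-- The hypersurface `{F = 0} ⊆ ℙ⁴` has sectional genus one: its general plane section is a
curve birational to a smooth plane cubic (i.e. of geometric genus `1`). -/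
def SectionalGenusOne (F : MvPolynomial (Fin 5) K) : Prop :=
  GenerallyOnGr K (Set.univ : Set (Grass K 3 4)) (fun P =>
    ∃ q : MvPolynomial (Fin 3) K, IsSmoothPlaneCubic K q ∧
      AreBirational K (projZeros K F ∩ projLinear K P.1) (projZeros (N := 2) K q))

/-- The length of a module, as the Krull dimension of its lattice of submodules. -/
def moduleLength (R M : Type) [CommRing R] [AddCommGroup M] [Module R M] : WithBot ℕ∞ :=
  Order.krullDim (Submodule R M)

/-- The length of the localization of `R/I` at (the complement of) `p`:  when `p` is a prime
containing `I` this is the intersection multiplicity of the scheme `V(I)` at `p`. -/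
def localLength {R : Type} [CommRing R] (I p : Ideal R) : WithBot ℕ∞ :=
  moduleLength (Localization (Submonoid.closure {s : R | s ∉ p}))
    (LocalizedModule (Submonoid.closure {s : R | s ∉ p}) (R ⧸ I))

/-- The frame-coordinate ideal of the Schubert variety of lines contained in the hyperplane
with coefficient vector `L`. -/
def hypFrameIdeal (L : Fin 5 → K) : Ideal (MvPolynomial (Fin 2 × Fin 5) K) :=
  Ideal.span {∑ j, C (L j) * X ((0 : Fin 2), j), ∑ j, C (L j) * X ((1 : Fin 2), j)}

/-- The restriction of a polynomial to the line spanned by `v` and `w`, as a binary form in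
the parameters. -/
def restrictLine {N : ℕ} (v w : Fin (N + 1) → K) (G : MvPolynomial (Fin (N + 1)) K) :
    MvPolynomial (Fin 2) K :=
  aeval (fun j => C (v j) * X 0 + C (w j) * X 1) G

/-- The homogeneous polynomials vanishing on a subset `S ⊆ ℙ^N`. -/
def homVanishing {N : ℕ} (S : Set (PP K N)) : Set (MvPolynomial (Fin (N + 1)) K) :=
  {f | ∀ x ∈ S, ∀ v ∈ x.submodule, eval v f = 0}

/-- The embedded (projectivized) tangent space to the subset `S ⊆ ℙ^N` at the point `P`. -/
def projTangentAt {N : ℕ} (S : Set (PP K N)) (P : PP K N) : Set (PP K N) :=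
  {y | ∀ f ∈ homVanishing K S, ∀ v ∈ P.submodule, ∀ w ∈ y.submodule,
    ∑ i, eval v (pderiv i f) * w i = 0}

/-- `P` is a smooth point of the surface `S`: its embedded tangent space is a plane. -/
def IsSmoothSurfacePoint {N : ℕ} (S : Set (PP K N)) (P : PP K N) : Prop :=
  P ∈ S ∧ ∃ W : Submodule K (Fin (N + 1) → K), Module.finrank K W = 3 ∧
    projTangentAt K S P = projLinear K W

/-- The line `L` is tangent to the surface `S` at the smooth point `P`. -/
def IsTangentLineAt {N : ℕ} (S : Set (PP K N)) (L : Grass K 2 N) (P : PP K N) : Prop :=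
  IsSmoothSurfacePoint K S P ∧ P ∈ projLinear K L.1 ∧
    projLinear K L.1 ⊆ projTangentAt K S P

/-- The surface `σ(r)`: the union of the lines of the Fano family meeting the line `r`. -/
def sigmaSurf (F : MvPolynomial (Fin 5) K) (r : Grass K 2 4) : Set (PP K 4) :=
  {x | ∃ W ∈ fanoSet K F, (projLinear K W.1 ∩ projLinear K r.1).Nonempty ∧
    x ∈ projLinear K W.1}

/-- Substitution of a linear endomorphism into a polynomial: `linSubst φ P = P ∘ φ`. -/
def linSubst {m : ℕ} (φ : (Fin m → K) →ₗ[K] (Fin m → K)) (P : MvPolynomial (Fin m) K) :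
    MvPolynomial (Fin m) K :=
  aeval (fun i => ∑ j, C (φ (Pi.single j 1) i) * X j) P

/-- Dehomogenization with respect to the coordinate `x₀`. -/
def dehomAt0 {m : ℕ} (P : MvPolynomial (Fin (m + 1)) K) : MvPolynomial (Fin m) K :=
  aeval (fun i : Fin (m + 1) => Fin.cases 1 (fun j => X j) i) P

/-- The Gauss image (dual variety, up to closure) of the hypersurface `{F = 0} ⊆ ℙ^N`. -/
def dualVariety {N : ℕ} (F : MvPolynomial (Fin (N + 1)) K) : Set (PP K N) :=
  {h | ∃ x, SmoothAt K F x ∧ ∃ v ∈ x.submodule, ∃ hnz : gradVec K F v ≠ 0,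
    h = Projectivization.mk K (gradVec K F v) hnz}

theorem natCast_le_ringKrullDim_of_isIntegral {K A : Type} [Field K] [CommRing A] [Algebra K A]
    {s : ℕ} (g : MvPolynomial (Fin s) K →ₐ[K] A) (hg : Function.Injective g)
    (hint : g.IsIntegral) : (s : WithBot ℕ∞) ≤ ringKrullDim A := by
  algebraize [g.toRingHom]
  have : Algebra.IsIntegral (MvPolynomial (Fin s) K) A := ⟨hint⟩
  have hinj : Function.Injective (algebraMap (MvPolynomial (Fin s) K) A) := hg
  have hd : ringKrullDim (MvPolynomial (Fin s) K) = s := by simp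
  obtain ⟨l, hl⟩ := Order.le_krullDim_iff.1 hd.ge
  obtain ⟨Q, -, hQ, hQl⟩ := Ideal.exists_ideal_over_prime_of_isIntegral
    l.head.asIdeal (⊥ : Ideal A) (by
      intro x hx
      have : x = 0 := hinj (by simpa using hx)
      simp [this])
  have : Q.LiesOver l.head.asIdeal := ⟨hQl.symm⟩
  obtain ⟨L, hL, -⟩ := Ideal.exists_ltSeries_of_hasGoingUp l Q
  rw [← hl, ← hL]
  exact Order.LTSeries.length_le_krullDim L

theorem trdeg_fractionRing_le_of_ringKrullDim_eq {K A : Type} [Field K] [CommRing A] [IsDomain A]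
    [Algebra K A] [Algebra.FiniteType K A] {n : ℕ} (h : ringKrullDim A = n) :
    Algebra.trdeg K (FractionRing A) ≤ n := by
  obtain ⟨s, g, hg, hint⟩ := exists_integral_inj_algHom_of_fg K A
  have hs := natCast_le_ringKrullDim_of_isIntegral g hg hint
  rw [h] at hs
  have hs' : s ≤ n := by exact_mod_cast hs
  algebraize [g.toRingHom]
  have : Algebra.IsIntegral (MvPolynomial (Fin s) K) A := ⟨hint⟩
  have hinj : Function.Injective (algebraMap (MvPolynomial (Fin s) K) A) := hg
  have : IsScalarTower K (MvPolynomial (Fin s) K) A := .of_algHom g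
  have : FaithfulSMul (MvPolynomial (Fin s) K) A := (faithfulSMul_iff_algebraMap_injective _ _).2 hinj
  have e1 := trdeg_add_eq K (MvPolynomial (Fin s) K) (A := A)
  have : FaithfulSMul K A := inferInstance
  have e2 := trdeg_add_eq K A (A := FractionRing A)
  have : Algebra.IsAlgebraic A (FractionRing A) := IsLocalization.isAlgebraic (FractionRing A) (nonZeroDivisors A)
  rw [trdeg_eq_zero (R := MvPolynomial (Fin s) K), add_zero] at e1
  rw [trdeg_eq_zero (R := A), add_zero] at e2
  rw [← e2, ← e1, MvPolynomial.trdeg_of_isDomain]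
  simpa using hs'

theorem derivation_eq_zero_of_isTranscendenceBasis {K L : Type} [Field K] [CharZero K] [Field L]
    [Algebra K L] (B : Set L) (hB : IsTranscendenceBasis K ((↑) : B → L))
    (D : Derivation K L L) (hD : ∀ b ∈ B, D b = 0) : D = 0 := by
  let E := IntermediateField.adjoin K B
  have : Algebra.IsAlgebraic E L := by
    have := hB.isAlgebraic_field
    rwa [Subtype.range_coe] at this
  have hE : ∀ x ∈ E, D x = 0 := by
    intro x hx
    induction hx using IntermediateField.adjoin_induction with
    | mem x hx => exact hD x hx
    | algebraMap x => simp
    | add x y _ _ hx hy => simp [hx, hy]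
    | inv x _ hx => simp [Derivation.leibniz_inv, hx]
    | mul x y _ _ hx hy => simp [hx, hy]
  have : CharZero E := charZero_of_injective_algebraMap (algebraMap K E).injective
  have : Algebra.FormallyUnramified E L := Algebra.FormallyUnramified.of_isSeparable E L
  let D' : Derivation E L L :=
    { toFun := D
      map_add' := D.map_add
      map_smul' := fun c x => by
        simp [Algebra.smul_def, hE c.1 c.2, IntermediateField.algebraMap_apply]
      map_one_eq_zero' := by simp
      leibniz' := D.leibniz }
  have h0 : D' = 0 := (KaehlerDifferential.linearMapEquivDerivation E L).symm.injective
    (Subsingleton.elim _ _)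
  ext x
  exact congrArg (fun d : Derivation E L L => d x) h0

theorem exists_difference_quotient {σ : Type} [Fintype σ] (F : MvPolynomial σ K) :
    ∃ H : σ → MvPolynomial (σ ⊕ σ) K,
      (∀ p q : σ → K, eval p F - eval q F = ∑ j, eval (Sum.elim p q) (H j) * (p j - q j)) ∧
      ∀ (q : σ → K) (j : σ), eval (Sum.elim q q) (H j) = eval q (pderiv j F) := by
  classical
  induction F using MvPolynomial.induction_on with
  | C a => exact ⟨0, by simp, by simp⟩
  | add f g hf hg =>
    obtain ⟨H₁, h₁, h₁'⟩ := hf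
    obtain ⟨H₂, h₂, h₂'⟩ := hg
    refine ⟨H₁ + H₂, fun p q => ?_, fun q j => by simp [h₁', h₂']⟩
    simp only [map_add, Pi.add_apply, add_mul, Finset.sum_add_distrib, ← h₁, ← h₂]
    ring
  | mul_X f i hf =>
    obtain ⟨H, h, h'⟩ := hf
    refine ⟨fun j => H j * X (Sum.inl i) + if j = i then rename Sum.inr f else 0,
      fun p q => ?_, fun q j => ?_⟩
    · have hr : eval (Sum.elim p q) (rename Sum.inr f) = eval q f := by
        rw [eval_rename]; rfl
      have : ∀ j, eval (Sum.elim p q) (H j * X (Sum.inl i) + if j = i then rename Sum.inr f else 0)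
          * (p j - q j) = p i * (eval (Sum.elim p q) (H j) * (p j - q j)) +
            if j = i then eval q f * (p j - q j) else 0 := by
        intro j
        split_ifs
        · simp only [map_add, map_mul, eval_X, Sum.elim_inl, hr]; ring
        · simp only [map_mul, eval_X, Sum.elim_inl, add_zero]; ring
      simp only [this, Finset.sum_add_distrib, ← Finset.mul_sum, ← h, map_mul, eval_X,
        Finset.sum_ite_eq', Finset.mem_univ, if_true]
      ring
    · have hr : eval (Sum.elim q q) (rename Sum.inr f) = eval q f := by
        rw [eval_rename]; rfl
      by_cases hij : j = i
      · subst hij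
        simp [h', hr, Derivation.leibniz, mul_comm]
        ring
      · simp [h', hij, Derivation.leibniz, pderiv_X, mul_comm]

variable {K}

theorem eval_eq_zero_of_forall_ne_zero {σ : Type} [Infinite K] (G : MvPolynomial σ K)
    (x y : σ → K) (h : ∀ ε : K, ε ≠ 0 → eval (x + ε • y) G = 0) : eval x G = 0 := by
  let P : Polynomial K := aeval (fun i => Polynomial.C (x i) + Polynomial.X * Polynomial.C (y i)) G
  have hP : ∀ ε, P.eval ε = eval (x + ε • y) G := by
    intro ε
    have : (Polynomial.aeval ε).comp (aeval (fun i => Polynomial.C (x i) +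
        Polynomial.X * Polynomial.C (y i))) = aeval (R := K) (x + ε • y) := by
      ext i
      simp only [AlgHom.comp_apply, aeval_X, map_add, map_mul, Polynomial.aeval_C,
        Polynomial.aeval_X, Algebra.algebraMap_self, RingHom.id_apply, Pi.add_apply, Pi.smul_apply, smul_eq_mul]
    have := congrArg (fun f => f G) this
    simpa [P, aeval_eq_eval, Polynomial.coe_aeval_eq_eval] using this
  have h0 : P = 0 := by
    apply Polynomial.eq_zero_of_infinite_isRoot
    refine (Set.finite_singleton (0 : K)).infinite_compl.mono fun ε hε => ?_
    simp only [Set.mem_ofPred_eq, Polynomial.IsRoot, hP]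
    exact h ε hε
  simpa [h0] using (hP 0).symm

theorem eval_eq_zero_of_mem_fanoSet {N : ℕ} {F : MvPolynomial (Fin (N + 1)) K} {W : Grass K 2 N}
    (hW : W ∈ fanoSet K F) {v : Fin (N + 1) → K} (hv : v ∈ W.1) : eval v F = 0 := by
  have key : ∀ w ∈ W.1, w ≠ 0 → ∀ c : K, eval (c • w) F = 0 := by
    intro w hw hw0 c
    refine hW (a := Projectivization.mk K w hw0) ?_ _ ?_
    · simpa [projLinear, Projectivization.submodule_mk, Submodule.span_le] using hw
    · rw [Projectivization.submodule_mk]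
      exact Submodule.smul_mem _ _ (Submodule.mem_span_singleton_self w)
  by_cases h0 : v = 0
  · have : W.1 ≠ ⊥ := by
      intro hb
      have := W.2
      rw [hb] at this
      simp at this
    obtain ⟨w, hw, hw0⟩ := Submodule.exists_mem_ne_zero_of_ne_bot this
    simpa [h0] using key w hw hw0 0
  · simpa using key v hv h0 1

theorem sum_gradVec_mul_eq_zero {N : ℕ} [Infinite K] {F : MvPolynomial (Fin (N + 1)) K}
    {W : Submodule K (Fin (N + 1) → K)} (hW : ∀ v ∈ W, eval v F = 0) {q v : Fin (N + 1) → K}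
    (hq : q ∈ W) (hv : v ∈ W) : ∑ j, gradVec K F q j * v j = 0 := by
  obtain ⟨H, hH, hH'⟩ := exists_difference_quotient K F
  have := eval_eq_zero_of_forall_ne_zero (∑ j, H j * C (v j)) (Sum.elim q q) (Sum.elim v 0) ?_
  · simpa [hH', gradVec] using this
  intro ε hε
  have h1 := hH (q + ε • v) q
  rw [hW _ hq, hW _ (W.add_mem hq (W.smul_mem ε hv))] at h1
  have h2 : (Sum.elim q q + ε • Sum.elim v 0 : Fin (N + 1) ⊕ Fin (N + 1) → K)
      = Sum.elim (q + ε • v) q := by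
    ext (i | i) <;> simp
  rw [h2]
  have h3 : ∑ j, eval (Sum.elim (q + ε • v) q) (H j) * ((q + ε • v) j - q j)
      = ε * eval (Sum.elim (q + ε • v) q) (∑ j, H j * C (v j)) := by
    simp only [Pi.add_apply, Pi.smul_apply, smul_eq_mul, add_sub_cancel_left, map_sum, map_mul,
      eval_C, Finset.mul_sum]
    exact Finset.sum_congr rfl fun j _ => by ring
  rw [h3, sub_zero] at h1
  exact (mul_eq_zero.1 h1.symm).resolve_left hε

/-- The value at `q` of the unnormalized section of the line spanned by `x` and `y` which has the
same `a`-th and `b`-th coordinates as `q`, up to the factor `x a * y b - x b * y a`. -/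
def lineSection {S : Type} [CommRing S] (a b : Fin 5) (x y q : Fin 5 → S) : Fin 5 → S :=
  (q a * y b - q b * y a) • x + (q b * x a - q a * x b) • y

/-- The polynomial in the frame coordinates whose nonvanishing excludes the lines meeting a
given line. -/
def separatingPoly (H : Fin 5 → MvPolynomial (Fin 5 ⊕ Fin 5) K) (q : Fin 3 → Fin 5 → K)
    (a b : Fin 5) : MvPolynomial (Fin 2 × Fin 5) K :=
  let x : Fin 5 → MvPolynomial (Fin 2 × Fin 5) K := fun j => X (0, j)
  let y : Fin 5 → MvPolynomial (Fin 2 × Fin 5) K := fun j => X (1, j)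
  let Δ := x a * y b - x b * y a
  let row : Fin 3 → Fin 5 → MvPolynomial (Fin 2 × Fin 5) K := fun k j =>
    aeval (Sum.elim (lineSection a b x y (fun i => C (q k i))) (fun i => Δ * C (q k i))) (H j)
  Δ * (Matrix.of ![row 0, row 1, row 2, Pi.single a 1, Pi.single b 1]).det

theorem eval_separatingPoly (H : Fin 5 → MvPolynomial (Fin 5 ⊕ Fin 5) K) (q : Fin 3 → Fin 5 → K)
    (a b : Fin 5) (p : Fin 2 × Fin 5 → K) :
    eval p (separatingPoly H q a b) =
      (p (0, a) * p (1, b) - p (0, b) * p (1, a)) *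
      (Matrix.of ![
        fun j => eval (Sum.elim (lineSection a b (fun i => p (0, i)) (fun i => p (1, i)) (q 0))
          ((p (0, a) * p (1, b) - p (0, b) * p (1, a)) • q 0)) (H j),
        fun j => eval (Sum.elim (lineSection a b (fun i => p (0, i)) (fun i => p (1, i)) (q 1))
          ((p (0, a) * p (1, b) - p (0, b) * p (1, a)) • q 1)) (H j),
        fun j => eval (Sum.elim (lineSection a b (fun i => p (0, i)) (fun i => p (1, i)) (q 2))
          ((p (0, a) * p (1, b) - p (0, b) * p (1, a)) • q 2)) (H j),
        Pi.single a 1, Pi.single b 1]).det := by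
  have key : ∀ (k : Fin 3) (G : MvPolynomial (Fin 5 ⊕ Fin 5) K),
      eval p (aeval (Sum.elim (lineSection a b
        (fun j => (X (0, j) : MvPolynomial (Fin 2 × Fin 5) K)) (fun j => X (1, j))
        (fun i => C (q k i))) (fun i => (X (0, a) * X (1, b) - X (0, b) * X (1, a)) * C (q k i))) G)
      = eval (Sum.elim (lineSection a b (fun i => p (0, i)) (fun i => p (1, i)) (q k))
          ((p (0, a) * p (1, b) - p (0, b) * p (1, a)) • q k)) G := by
    intro k G
    induction G using MvPolynomial.induction_on with
    | C c => simp
    | add f g hf hg => simp only [map_add, hf, hg]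
    | mul_X f i hf =>
      rw [map_mul, map_mul, hf, map_mul]
      congr 1
      rcases i with i | i <;> simp [lineSection]
  rw [separatingPoly, map_mul, RingHom.map_det]
  congr 1
  · simp
  · congr 1
    ext i j
    fin_cases i
    · simpa using key 0 (H j)
    · simpa using key 1 (H j)
    · simpa using key 2 (H j)
    · change eval p ((Pi.single a 1 : Fin 5 → MvPolynomial (Fin 2 × Fin 5) K) j) =
        (Pi.single a 1 : Fin 5 → K) j
      rw [Pi.single_apply, Pi.single_apply]; split_ifs <;> simp
    · change eval p ((Pi.single b 1 : Fin 5 → MvPolynomial (Fin 2 × Fin 5) K) j) =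
        (Pi.single b 1 : Fin 5 → K) j
      rw [Pi.single_apply, Pi.single_apply]; split_ifs <;> simp

/-- The projection of a line to the `a`-th and `b`-th coordinates. -/
def coordPair (a b : Fin 5) (W : Submodule K (Fin 5 → K)) : W →ₗ[K] K × K :=
  ((LinearMap.proj a).prod (LinearMap.proj b)).comp W.subtype

theorem coordPair_injective_iff_surjective (a b : Fin 5) (W : Grass K 2 4) :
    Function.Injective (coordPair a b W.1) ↔ Function.Surjective (coordPair a b W.1) := by
  have h2 : Module.finrank K W.1 = 2 := W.2
  have : FiniteDimensional K W.1 := inferInstance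
  exact LinearMap.injective_iff_surjective_of_finrank_eq_finrank (by rw [h2]; simp)

theorem ext_of_coords {a b : Fin 5} {W : Grass K 2 4}
    (h : Function.Injective (coordPair a b W.1)) {u v : Fin 5 → K} (hu : u ∈ W.1) (hv : v ∈ W.1)
    (h₁ : u a = v a) (h₂ : u b = v b) : u = v := by
  have := @h ⟨u, hu⟩ ⟨v, hv⟩ (Prod.ext h₁ h₂)
  exact congrArg Subtype.val this

theorem det_eq_zero_of_meets [Infinite K] {F : MvPolynomial (Fin 5) K}
    {H : Fin 5 → MvPolynomial (Fin 5 ⊕ Fin 5) K}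
    (hH : ∀ p q : Fin 5 → K,
      eval p F - eval q F = ∑ j, eval (Sum.elim p q) (H j) * (p j - q j))
    {r r' : Grass K 2 4} (hr : r ∈ fanoSet K F) (hr' : r' ∈ fanoSet K F) (hne : r' ≠ r)
    {c₀ : Fin 5 → K} (hc₀ : c₀ ≠ 0) (hc₀r : c₀ ∈ r.1) (hc₀r' : c₀ ∈ r'.1)
    {q : Fin 3 → Fin 5 → K} (hq : ∀ k, q k ∈ r.1) (a b : Fin 5) {p : Fin 2 × Fin 5 → K}
    (hp : frameMem K p r'.1) : eval p (separatingPoly H q a b) = 0 := by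
  set x : Fin 5 → K := fun i => p (0, i) with hx
  set y : Fin 5 → K := fun i => p (1, i) with hy
  have hxr : x ∈ r'.1 := hp 0
  have hyr : y ∈ r'.1 := hp 1
  rw [eval_separatingPoly]
  set Δ := p (0, a) * p (1, b) - p (0, b) * p (1, a) with hΔ
  have hΔ' : Δ = x a * y b - x b * y a := rfl
  by_cases hΔ0 : Δ = 0
  · rw [hΔ0, zero_mul]
  refine mul_eq_zero_of_right _ (Matrix.exists_mulVec_eq_zero_iff.1 ?_)
  have hinj : Function.Injective (coordPair a b r'.1) := by
    rw [coordPair_injective_iff_surjective]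
    rintro ⟨s, t⟩
    refine ⟨Δ⁻¹ • ((s * y b - t * y a) • ⟨x, hxr⟩ + (t * x a - s * x b) • ⟨y, hyr⟩), ?_⟩
    ext
    · change Δ⁻¹ * ((s * y b - t * y a) * x a + (t * x a - s * x b) * y a) = s
      rw [inv_mul_eq_iff_eq_mul₀ hΔ0, hΔ']; ring
    · change Δ⁻¹ * ((s * y b - t * y a) * x b + (t * x a - s * x b) * y b) = t
      rw [inv_mul_eq_iff_eq_mul₀ hΔ0, hΔ']; ring
  have hsec : ∀ u, lineSection a b x y u ∈ r'.1 := fun u =>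
    r'.1.add_mem (r'.1.smul_mem _ hxr) (r'.1.smul_mem _ hyr)
  have hseca : ∀ u, lineSection a b x y u a = Δ * u a := by
    intro u; simp only [lineSection, Pi.add_apply, Pi.smul_apply, smul_eq_mul]; rw [hΔ']; ring
  have hsecb : ∀ u, lineSection a b x y u b = Δ * u b := by
    intro u; simp only [lineSection, Pi.add_apply, Pi.smul_apply, smul_eq_mul]; rw [hΔ']; ring
  have hsec0 : lineSection a b x y c₀ = Δ • c₀ :=
    ext_of_coords hinj (hsec _) (r'.1.smul_mem _ hc₀r') (hseca _) (hsecb _)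
  obtain ⟨c, hcr, hc⟩ : ∃ c ∈ r.1, lineSection a b x y c ≠ Δ • c := by
    by_contra! hcon
    refine hne (Subtype.ext (Submodule.eq_of_le_of_finrank_eq ?_ (r.2.trans r'.2.symm)).symm)
    intro u hu
    have := hsec u
    rw [hcon u hu] at this
    exact (r'.1.smul_mem_iff hΔ0).1 this
  have hlin : ∀ (s t : K) (u v : Fin 5 → K), lineSection a b x y (s • u + t • v) =
      s • lineSection a b x y u + t • lineSection a b x y v := by
    intro s t u v
    ext j
    simp only [lineSection, Pi.add_apply, Pi.smul_apply, smul_eq_mul]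
    ring
  set e := lineSection a b x y c - Δ • c with he
  have hspan : ∀ u ∈ r.1, ∃ s t : K, u = s • c₀ + t • c := by
    have hli : LinearIndependent K ![c₀, c] := by
      rw [LinearIndependent.pair_iff' hc₀]
      rintro s rfl
      apply hc
      have := hlin s 0 c₀ 0
      simp only [zero_smul, add_zero] at this
      rw [this, hsec0, smul_comm]
    have hle : Submodule.span K (Set.range ![c₀, c]) ≤ r.1 := by
      rw [Submodule.span_le]
      rintro _ ⟨i, rfl⟩
      fin_cases i
      · exact hc₀r
      · exact hcr
    have heq := Submodule.eq_of_le_of_finrank_eq hle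
      ((finrank_span_eq_card hli).trans (by rw [r.2]; simp))
    intro u hu
    rw [← heq, Matrix.range_cons, Matrix.range_cons, Matrix.range_empty, Set.union_empty,
      Set.singleton_union, Submodule.mem_span_pair] at hu
    obtain ⟨s, t, h⟩ := hu
    exact ⟨s, t, h.symm⟩
  have hker : ∀ u ∈ r.1, ∑ j, eval (Sum.elim (lineSection a b x y u) (Δ • u)) (H j) * e j = 0 := by
    have hker' : ∀ s t : K, t ≠ 0 → ∑ j, eval (Sum.elim (lineSection a b x y (s • c₀ + t • c))
        (Δ • (s • c₀ + t • c))) (H j) * e j = 0 := by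
      intro s t ht
      have hu : s • c₀ + t • c ∈ r.1 := r.1.add_mem (r.1.smul_mem _ hc₀r) (r.1.smul_mem _ hcr)
      have h1 := hH (lineSection a b x y (s • c₀ + t • c)) (Δ • (s • c₀ + t • c))
      rw [eval_eq_zero_of_mem_fanoSet hr' (hsec _),
        eval_eq_zero_of_mem_fanoSet hr (r.1.smul_mem _ hu), sub_zero] at h1
      have h2 : ∀ j, lineSection a b x y (s • c₀ + t • c) j - (Δ • (s • c₀ + t • c)) j
          = t * e j := by
        intro j
        rw [hlin, hsec0, he]
        simp only [Pi.add_apply, Pi.smul_apply, Pi.sub_apply, smul_eq_mul]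
        ring
      simp only [h2, mul_left_comm _ t, ← Finset.mul_sum] at h1
      exact (mul_eq_zero.1 h1.symm).resolve_left ht
    intro u hu
    obtain ⟨s, t, rfl⟩ := hspan u hu
    by_cases ht : t = 0
    · subst ht
      have := eval_eq_zero_of_forall_ne_zero (∑ j, H j * C (e j))
        (Sum.elim (lineSection a b x y (s • c₀)) (Δ • (s • c₀)))
        (Sum.elim (lineSection a b x y c) (Δ • c)) ?_
      · simpa using this
      intro ε hε
      have h3 : Sum.elim (lineSection a b x y (s • c₀)) (Δ • (s • c₀)) +
          ε • Sum.elim (lineSection a b x y c) (Δ • c) =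
          Sum.elim (lineSection a b x y (s • c₀ + ε • c)) (Δ • (s • c₀ + ε • c)) := by
        have h4 := hlin s 0 c₀ 0
        simp only [zero_smul, add_zero] at h4
        rw [hlin, h4]
        ext (i | i)
        · simp
        · simp [mul_left_comm]
      rw [h3]
      simpa using hker' s ε hε
    · exact hker' s t ht
  refine ⟨e, sub_ne_zero.2 hc, ?_⟩
  ext i
  fin_cases i
  · exact hker _ (hq 0)
  · exact hker _ (hq 1)
  · exact hker _ (hq 2)
  · simp [Matrix.mulVec, he, hseca]
  · simp [Matrix.mulVec, he, hsecb]

theorem notMem_grClosure_of_det_ne_zero [Infinite K] {F : MvPolynomial (Fin 5) K}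
    {r : Grass K 2 4} (hr : r ∈ fanoSet K F) {S : Set (Grass K 2 4)}
    (hS : ∀ r' ∈ S, r' ∈ fanoSet K F ∧ r' ≠ r ∧
      (projLinear K r'.1 ∩ projLinear K r.1).Nonempty)
    {q : Fin 3 → Fin 5 → K} (hq : ∀ k, q k ∈ r.1) {a b : Fin 5}
    (hdet : (Matrix.of ![gradVec K F (q 0), gradVec K F (q 1), gradVec K F (q 2),
      Pi.single a 1, Pi.single b 1]).det ≠ 0) : r ∉ grClosure K S := by
  obtain ⟨H, hH, hH'⟩ := exists_difference_quotient K F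
  set G := separatingPoly H q a b with hG
  have hinj : Function.Injective (coordPair a b r.1) := by
    rw [← LinearMap.ker_eq_bot, Submodule.eq_bot_iff]
    rintro ⟨u, hu⟩ hu0
    have h1 : u a = 0 := congrArg Prod.fst hu0
    have h2 : u b = 0 := congrArg Prod.snd hu0
    by_contra hne
    refine hdet (Matrix.exists_mulVec_eq_zero_iff.1 ⟨u, fun h => hne (Subtype.ext h), ?_⟩)
    have h0 : ∀ k, ∑ j, gradVec K F (q k) j * u j = 0 := fun k =>
      sum_gradVec_mul_eq_zero (fun v hv => eval_eq_zero_of_mem_fanoSet hr hv) (hq k) hu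
    ext i
    fin_cases i
    · exact h0 0
    · exact h0 1
    · exact h0 2
    · simp [Matrix.mulVec, h1]
    · simp [Matrix.mulVec, h2]
  have hsurj := (coordPair_injective_iff_surjective a b r).1 hinj
  obtain ⟨⟨x, hx⟩, hx'⟩ := hsurj (1, 0)
  obtain ⟨⟨y, hy⟩, hy'⟩ := hsurj (0, 1)
  have hxa : x a = 1 := congrArg Prod.fst hx'
  have hxb : x b = 0 := congrArg Prod.snd hx'
  have hya : y a = 0 := congrArg Prod.fst hy'
  have hyb : y b = 1 := congrArg Prod.snd hy'
  intro hmem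
  have hmem' := hmem {W | ∀ G' ∈ ({G} : Set (MvPolynomial (Fin 2 × Fin 5) K)), ∀ p,
    frameMem K p W.1 → eval p G' = 0} ⟨⟨{G}, rfl⟩, ?_⟩
  · have h := hmem' G rfl (fun i => ![x, y] i.1 i.2) (by
      intro i
      fin_cases i
      · exact hx
      · exact hy)
    rw [hG, eval_separatingPoly] at h
    have hsec : ∀ k, lineSection a b x y (q k) = q k := fun k =>
      ext_of_coords hinj (r.1.add_mem (r.1.smul_mem _ hx) (r.1.smul_mem _ hy)) (hq k)
        (by simp [lineSection, hxa, hxb, hya, hyb]) (by simp [lineSection, hxa, hxb, hya, hyb])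
    simp only [Matrix.cons_val_zero, Matrix.cons_val_one, hxa, hyb, hxb, hya, mul_one, mul_zero,
      sub_zero, one_smul, one_mul] at h
    have hrow : ∀ k, (fun j => eval (Sum.elim (lineSection a b x y (q k)) (q k)) (H j)) =
        gradVec K F (q k) := by
      intro k
      funext j
      rw [hsec, hH', gradVec]
    exact hdet (by rw [← hrow, ← hrow, ← hrow]; exact h)
  · intro r' hr'
    rintro _ rfl p hp
    obtain ⟨h1, h2, ⟨z, hz1, hz2⟩⟩ := hS r' hr'
    have hz : z.rep ∈ z.submodule := by
      rw [Projectivization.submodule_eq]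
      exact Submodule.mem_span_singleton_self _
    exact det_eq_zero_of_meets hH hr h1 h2 z.rep_nonzero (hz2 hz) (hz1 hz) hq a b hp

/-- The expansion of `F (s v + t w)` in `s` and `t`, with coefficients in the frame
coordinates. -/
def fanoForm {N : ℕ} (F : MvPolynomial (Fin (N + 1)) K) :
    MvPolynomial (Fin 2) (MvPolynomial (Fin 2 × Fin (N + 1)) K) :=
  aeval (fun j : Fin (N + 1) =>
    (X 0 : MvPolynomial (Fin 2) (MvPolynomial (Fin 2 × Fin (N + 1)) K)) * C (X (0, j)) +
      X 1 * C (X (1, j))) F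

theorem eval_fanoForm {N : ℕ} (F : MvPolynomial (Fin (N + 1)) K) (c : Fin 2 → K) :
    eval (fun i => C (c i)) (fanoForm F) =
      aeval (fun j : Fin (N + 1) => c 0 • (X (0, j) : MvPolynomial (Fin 2 × Fin (N + 1)) K) +
        c 1 • X (1, j)) F := by
  induction F using MvPolynomial.induction_on with
  | C a => simp [fanoForm, MvPolynomial.algebraMap_apply]
  | add f g hf hg => simp only [fanoForm, map_add] at hf hg ⊢; rw [hf, hg]
  | mul_X f i hf =>
    simp only [fanoForm, map_mul] at hf ⊢
    rw [hf]
    simp [smul_eq_C_mul]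

theorem map_coeff_eq_zero_of_map_eval_eq_zero [Infinite K] {R L τ : Type} [CommRing R] [Algebra K R]
    [Field L] [Algebra K L] (ℓ : R →ₗ[K] L) (Φ : MvPolynomial τ R)
    (h : ∀ c : τ → K, ℓ (eval (fun i => algebraMap K R (c i)) Φ) = 0) (d : τ →₀ ℕ) :
    ℓ (coeff d Φ) = 0 := by
  classical
  let Ψ : MvPolynomial τ L := ∑ d ∈ Φ.support, monomial d (ℓ (coeff d Φ))
  have hΨ : coeff d Ψ = ℓ (coeff d Φ) := by
    simp only [Ψ, coeff_sum, coeff_monomial, Finset.sum_ite_eq', mem_support_iff]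
    split_ifs with hd
    · rfl
    · rw [not_not.1 hd, map_zero]
  rw [← hΨ]
  have h0 : Ψ = 0 := by
    apply funext_set (fun _ => Set.range (algebraMap K L))
      (fun _ => Set.infinite_range_of_injective (algebraMap K L).injective)
    intro x hx
    have hx' : ∀ i, ∃ c : K, algebraMap K L c = x i := fun i => hx i trivial
    choose c hc using hx'
    rw [map_zero, ← h c, eval_eq _ Φ]
    simp only [Ψ, map_sum, eval_monomial]
    refine Finset.sum_congr rfl fun d _ => ?_
    have h1 : ∏ i ∈ d.support, (algebraMap K R (c i)) ^ d i =
        algebraMap K R (∏ i ∈ d.support, c i ^ d i) := by simp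
    rw [h1, mul_comm (coeff d Φ), ← Algebra.smul_def, map_smul, Algebra.smul_def, mul_comm]
    simp [Finsupp.prod, hc]
  rw [h0, coeff_zero]

theorem linearMap_eq_zero_of_mem_fanoIdeal [Infinite K] {N : ℕ} {F : MvPolynomial (Fin (N + 1)) K}
    {L : Type} [Field L] [Algebra K L] (ℓ : MvPolynomial (Fin 2 × Fin (N + 1)) K →ₗ[K] L)
    (h : ∀ s t : K, ℓ (aeval (fun j : Fin (N + 1) =>
      s • (X (0, j) : MvPolynomial (Fin 2 × Fin (N + 1)) K) + t • X (1, j)) F) = 0)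
    (d : Fin 2 →₀ ℕ) : ℓ (coeff d (fanoForm F)) = 0 := by
  refine map_coeff_eq_zero_of_map_eval_eq_zero ℓ _ (fun c => ?_) d
  rw [algebraMap_eq, eval_fanoForm]
  exact h _ _

theorem aeval_mem_fanoIdeal {N : ℕ} (F : MvPolynomial (Fin (N + 1)) K) (s t : K) :
    aeval (fun j : Fin (N + 1) =>
      s • (X (0, j) : MvPolynomial (Fin 2 × Fin (N + 1)) K) + t • X (1, j)) F ∈
        fanoIdeal K F := by
  have := eval_fanoForm F ![s, t]
  rw [eval_eq] at this
  simp only [Matrix.cons_val_zero, Matrix.cons_val_one] at this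
  rw [← this]
  exact Ideal.sum_mem _ fun d _ => Ideal.mul_mem_right _ _ (Ideal.subset_span ⟨d, rfl⟩)

theorem eval_aeval_smul_add_smul {N : ℕ} (F : MvPolynomial (Fin (N + 1)) K) (s t : K)
    (p : Fin 2 × Fin (N + 1) → K) :
    eval p (aeval (fun j : Fin (N + 1) =>
      s • (X (0, j) : MvPolynomial (Fin 2 × Fin (N + 1)) K) + t • X (1, j)) F) =
      eval (s • (fun j => p (0, j)) + t • fun j => p (1, j)) F := by
  induction F using MvPolynomial.induction_on with
  | C a => simp
  | add f g hf hg => simp only [map_add, hf, hg]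
  | mul_X f i hf => simp only [map_mul, hf]; simp

theorem mem_affVanishing_frameCone {k N : ℕ} {S : Set (Grass K k N)}
    {f : MvPolynomial (Fin k × Fin (N + 1)) K} :
    f ∈ affVanishing K (frameCone K k N S) ↔
      ∀ W ∈ S, ∀ p, frameMem K p W.1 → eval p f = 0 :=
  ⟨fun h W hW p hp => h p ⟨W, hW, hp⟩, fun h _ ⟨W, hW, hp⟩ => h W hW _ hp⟩

theorem fanoIdeal_le_affVanishing [Infinite K] {N : ℕ} {F : MvPolynomial (Fin (N + 1)) K}
    {S : Set (Grass K 2 N)} (hS : S ⊆ fanoSet K F) :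
    fanoIdeal K F ≤ affVanishing K (frameCone K 2 N S) := by
  refine Ideal.span_le.2 ?_
  rintro _ ⟨d, rfl⟩
  refine mem_affVanishing_frameCone.2 fun W hW p hp => ?_
  refine linearMap_eq_zero_of_mem_fanoIdeal (aeval p).toLinearMap (fun s t => ?_) d
  refine (eval_aeval_smul_add_smul F s t p).trans (eval_eq_zero_of_mem_fanoSet (hS hW) ?_)
  exact W.1.add_mem (W.1.smul_mem _ (hp 0)) (W.1.smul_mem _ (hp 1))

theorem exists_eval_ne_zero_and_eval_ne_zero [Infinite K] {σ : Type} {f g : MvPolynomial σ K}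
    {x y : σ → K} (hf : eval x f ≠ 0) (hg : eval y g ≠ 0) :
    ∃ t : K, eval (x + t • (y - x)) f ≠ 0 ∧ eval (x + t • (y - x)) g ≠ 0 := by
  let ψ : MvPolynomial σ K →ₐ[K] Polynomial K :=
    aeval (fun i => Polynomial.C (x i) + Polynomial.X * Polynomial.C (y i - x i))
  have hψ : ∀ t h, (ψ h).eval t = eval (x + t • (y - x)) h := by
    intro t h
    have : (Polynomial.aeval t).comp ψ = aeval (R := K) (x + t • (y - x)) := by
      ext i
      simp only [ψ, AlgHom.comp_apply, aeval_X, map_add, map_mul, Polynomial.aeval_C,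
        Polynomial.aeval_X, Algebra.algebraMap_self, RingHom.id_apply, Pi.add_apply, Pi.smul_apply,
        smul_eq_mul, Pi.sub_apply]
    have := congrArg (fun f => f h) this
    simpa [aeval_eq_eval, Polynomial.coe_aeval_eq_eval] using this
  have hf' : ψ f ≠ 0 := fun h => hf (by simpa [h] using (hψ 0 f).symm)
  have hg' : ψ g ≠ 0 := fun h => hg (by simpa [h] using (hψ 1 g).symm)
  obtain ⟨t, ht⟩ : ∃ t, (ψ f * ψ g).eval t ≠ 0 := by
    by_contra! h
    exact mul_ne_zero hf' hg' (Polynomial.funext fun t => by simpa using h t)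
  rw [Polynomial.eval_mul, hψ, hψ] at ht
  exact ⟨t, left_ne_zero_of_mul ht, right_ne_zero_of_mul ht⟩

theorem isPrime_affVanishing_frameCone [Infinite K] {k N : ℕ} {S : Set (Grass K k N)}
    (hS : GrIrred K S) : (affVanishing K (frameCone K k N S)).IsPrime := by
  obtain ⟨⟨W₀, hW₀⟩, hS⟩ := hS
  refine ⟨?_, ?_⟩
  · rw [Ideal.ne_top_iff_one]
    intro h
    have := mem_affVanishing_frameCone.1 h W₀ hW₀ 0 (fun _ => W₀.1.zero_mem)
    simp at this
  · intro f g hfg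
    let V : MvPolynomial (Fin k × Fin (N + 1)) K → Set (Grass K k N) := fun f =>
      {W | ∀ G ∈ ({f} : Set (MvPolynomial (Fin k × Fin (N + 1)) K)),
        ∀ p, frameMem K p W.1 → eval p G = 0}
    have := hS (V f) (V g) ⟨_, rfl⟩ ⟨_, rfl⟩ fun W hW => ?_
    · refine this.imp (fun h => ?_) (fun h => ?_)
      · exact mem_affVanishing_frameCone.2 fun W hW => h hW _ rfl
      · exact mem_affVanishing_frameCone.2 fun W hW => h hW _ rfl
    · by_contra hcon
      rw [Set.mem_union, not_or] at hcon
      simp only [V, Set.mem_singleton_iff, forall_eq, Set.mem_ofPred_eq, not_forall] at hcon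
      obtain ⟨⟨x, hx, hfx⟩, ⟨y, hy, hgy⟩⟩ := hcon
      obtain ⟨t, h1, h2⟩ := exists_eval_ne_zero_and_eval_ne_zero hfx hgy
      have := mem_affVanishing_frameCone.1 hfg W hW (x + t • (y - x)) fun i =>
        W.1.add_mem (hx i) (W.1.smul_mem t (W.1.sub_mem (hy i) (hx i)))
      rw [map_mul] at this
      exact mul_ne_zero h1 h2 this

theorem exists_minor_ne_zero {N : ℕ} {x y : Fin (N + 1) → K}
    (h : LinearIndependent K ![x, y]) : ∃ a b, x a * y b - x b * y a ≠ 0 := by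
  by_contra! hcon
  obtain ⟨a, ha⟩ : ∃ a, x a ≠ 0 := Function.ne_iff.1 (h.ne_zero 0)
  refine (LinearIndependent.pair_iff' (h.ne_zero 0)).1 h (y a / x a) ?_
  ext b
  have := hcon a b
  simp only [Matrix.cons_val_zero, Pi.smul_apply, smul_eq_mul]
  field_simp
  linear_combination -this

theorem linearIndependent_of_minor_ne_zero {N : ℕ} {x y : Fin (N + 1) → K} {a b : Fin (N + 1)}
    (h : x a * y b - x b * y a ≠ 0) : LinearIndependent K ![x, y] := by
  rw [LinearIndependent.pair_iff]
  intro s t hst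
  have ha := congrFun hst a
  have hb := congrFun hst b
  simp only [Pi.add_apply, Pi.smul_apply, smul_eq_mul, Pi.zero_apply] at ha hb
  constructor
  · refine (mul_eq_zero.1 ?_).resolve_right h
    linear_combination y b * ha - y a * hb
  · refine (mul_eq_zero.1 ?_).resolve_right h
    linear_combination x a * hb - x b * ha

theorem exists_frame {N : ℕ} (W : Grass K 2 N) : ∃ p : Fin 2 × Fin (N + 1) → K,
    frameMem K p W.1 ∧ LinearIndependent K ![fun j => p (0, j), fun j => p (1, j)] := by
  have : Module.Finite K W.1 := inferInstance
  let B := Module.finBasisOfFinrankEq K W.1 W.2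
  refine ⟨fun ij => (B ij.1).1 ij.2, fun i => (B i).2, ?_⟩
  have h := B.linearIndependent.map' W.1.subtype W.1.ker_subtype
  have e : ![fun j => (B 0).1 j, fun j => (B 1).1 j] = W.1.subtype ∘ B := by
    ext i j
    fin_cases i <;> rfl
  rw [← e] at h
  exact h

theorem span_pair_eq {N : ℕ} {W : Grass K 2 N} {x y : Fin (N + 1) → K}
    (h : LinearIndependent K ![x, y]) (hx : x ∈ W.1) (hy : y ∈ W.1) :
    Submodule.span K {x, y} = W.1 := by
  have hr : Set.range ![x, y] = {x, y} := by simp [Set.pair_comm]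
  refine Submodule.eq_of_le_of_finrank_eq ?_ ?_
  · rw [Submodule.span_le]
    rintro _ (rfl | rfl)
    exacts [hx, hy]
  · rw [W.2, ← hr, finrank_span_eq_card h]
    simp

/-- The line spanned by a frame. -/
def lineOfFrame {N : ℕ} (p : Fin 2 × Fin (N + 1) → K)
    (h : LinearIndependent K ![fun j => p (0, j), fun j => p (1, j)]) : Grass K 2 N :=
  ⟨Submodule.span K {fun j => p (0, j), fun j => p (1, j)}, by
    have hr : Set.range ![fun j => p (0, j), fun j => p (1, j)] =
      {fun j => p (0, j), fun j => p (1, j)} := by simp [Set.pair_comm]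
    rw [← hr, finrank_span_eq_card h]
    simp⟩

theorem frameMem_lineOfFrame {N : ℕ} (p : Fin 2 × Fin (N + 1) → K)
    (h : LinearIndependent K ![fun j => p (0, j), fun j => p (1, j)]) :
    frameMem K p (lineOfFrame p h).1 := by
  intro i
  refine Submodule.subset_span ?_
  fin_cases i <;> simp

/-- The lines spanned by the linearly independent frames in the zero locus of an ideal. -/
def linesOfIdeal {N : ℕ} (Q : Ideal (MvPolynomial (Fin 2 × Fin (N + 1)) K)) : Set (Grass K 2 N) :=
  {W | ∃ p, (∀ f ∈ Q, eval p f = 0) ∧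
    ∃ h : LinearIndependent K ![fun j => p (0, j), fun j => p (1, j)], lineOfFrame p h = W}

/-- The polynomial `f` after a change of frame by the matrix `A`. -/
def changeFrame {N : ℕ} (A : Fin 2 → Fin 2 → K) (f : MvPolynomial (Fin 2 × Fin (N + 1)) K) :
    MvPolynomial (Fin 2 × Fin (N + 1)) K :=
  aeval (fun ij => A ij.1 0 • X (0, ij.2) + A ij.1 1 • X (1, ij.2)) f

theorem eval_changeFrame {N : ℕ} (A : Fin 2 → Fin 2 → K)
    (f : MvPolynomial (Fin 2 × Fin (N + 1)) K) (p : Fin 2 × Fin (N + 1) → K) :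
    eval p (changeFrame A f) =
      eval (fun ij => A ij.1 0 * p (0, ij.2) + A ij.1 1 * p (1, ij.2)) f := by
  unfold changeFrame
  induction f using MvPolynomial.induction_on with
  | C a => simp
  | add f g hf hg => simp only [map_add, hf, hg]
  | mul_X f i hf => simp only [map_mul, hf]; simp

theorem exists_eval_ne_zero_of_notMem [IsAlgClosed K] {σ : Type} [Finite σ]
    {Q : Ideal (MvPolynomial σ K)} [Q.IsPrime] {f : MvPolynomial σ K} (hf : f ∉ Q) :
    ∃ p, (∀ g ∈ Q, eval p g = 0) ∧ eval p f ≠ 0 := by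
  rw [← IsPrime.vanishingIdeal_zeroLocus (K := K) Q, mem_vanishingIdeal_iff] at hf
  push Not at hf
  obtain ⟨p, hp, hpf⟩ := hf
  exact ⟨p, fun g hg => by simpa [aeval_eq_eval] using hp g hg, by simpa [aeval_eq_eval] using hpf⟩

/-- The minor of the universal frame in the columns `a` and `b`. -/
def frameMinor {N : ℕ} (a b : Fin (N + 1)) : MvPolynomial (Fin 2 × Fin (N + 1)) K :=
  X (0, a) * X (1, b) - X (0, b) * X (1, a)

theorem eval_frameMinor {N : ℕ} (a b : Fin (N + 1)) (p : Fin 2 × Fin (N + 1) → K) :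
    eval p (frameMinor a b) = p (0, a) * p (1, b) - p (0, b) * p (1, a) := by
  simp [frameMinor]

theorem grIrred_linesOfIdeal [IsAlgClosed K] {N : ℕ}
    (Q : Ideal (MvPolynomial (Fin 2 × Fin (N + 1)) K)) [Q.IsPrime]
    (hne : (linesOfIdeal Q).Nonempty) : GrIrred K (linesOfIdeal Q) := by
  have key : ∀ C, GrClosed K C → ¬ linesOfIdeal Q ⊆ C → ∃ G, G ∉ Q ∧
      ∀ p h, eval p G ≠ 0 → lineOfFrame (K := K) (N := N) p h ∉ C := by
    rintro C ⟨𝒢, rfl⟩ hC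
    rw [Set.not_subset] at hC
    obtain ⟨_, ⟨p, hp, h, rfl⟩, hW⟩ := hC
    simp only [Set.mem_ofPred_eq, not_forall] at hW
    obtain ⟨G, hG, q, hq, hne⟩ := hW
    have hA : ∀ i, ∃ s t : K, s • (fun j => p (0, j)) + t • (fun j => p (1, j)) =
        fun j => q (i, j) := fun i => Submodule.mem_span_pair.1 (hq i)
    choose s t hst using hA
    let A : Fin 2 → Fin 2 → K := fun i => ![s i, t i]
    have hAq : (fun ij : Fin 2 × Fin (N + 1) => A ij.1 0 * p (0, ij.2) + A ij.1 1 * p (1, ij.2))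
        = q := by
      ext ⟨i, j⟩
      exact congrFun (hst i) j
    refine ⟨changeFrame A G, fun hmem => hne ?_, fun p' h' hp' hmem => hp' ?_⟩
    · rw [← hp _ hmem, eval_changeFrame, hAq]
    · rw [eval_changeFrame]
      refine hmem G hG _ fun i => ?_
      exact Submodule.add_mem _
        (Submodule.smul_mem _ (A i 0) (frameMem_lineOfFrame p' h' 0))
        (Submodule.smul_mem _ (A i 1) (frameMem_lineOfFrame p' h' 1))
  refine ⟨hne, fun C₁ C₂ h₁ h₂ hsub => ?_⟩
  by_contra! hcon
  obtain ⟨G₁, hG₁, h₁'⟩ := key C₁ h₁ hcon.1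
  obtain ⟨G₂, hG₂, h₂'⟩ := key C₂ h₂ hcon.2
  obtain ⟨_, p, hp, h, rfl⟩ := hne
  obtain ⟨a, b, hab⟩ := exists_minor_ne_zero h
  have hm : frameMinor a b ∉ Q := fun hmem => hab (by rw [← eval_frameMinor, hp _ hmem])
  have hprod : G₁ * G₂ * frameMinor a b ∉ Q := fun hmem => by
    rcases Ideal.IsPrime.mem_or_mem ‹_› hmem with hmem | hmem
    · rcases Ideal.IsPrime.mem_or_mem ‹_› hmem with hmem | hmem
      exacts [hG₁ hmem, hG₂ hmem]
    · exact hm hmem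
  obtain ⟨q, hq, hq'⟩ := exists_eval_ne_zero_of_notMem hprod
  rw [map_mul, map_mul, eval_frameMinor] at hq'
  have hli := linearIndependent_of_minor_ne_zero (x := fun j => q (0, j)) (y := fun j => q (1, j))
    (right_ne_zero_of_mul hq')
  have hq1 := left_ne_zero_of_mul hq'
  rcases hsub ⟨q, hq, hli, rfl⟩ with hC | hC
  · exact h₁' q hli (left_ne_zero_of_mul hq1) hC
  · exact h₂' q hli (right_ne_zero_of_mul hq1) hC

theorem linesOfIdeal_subset_fanoSet {N : ℕ} {F : MvPolynomial (Fin (N + 1)) K}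
    {Q : Ideal (MvPolynomial (Fin 2 × Fin (N + 1)) K)} (hQ : fanoIdeal K F ≤ Q) :
    linesOfIdeal Q ⊆ fanoSet K F := by
  rintro _ ⟨p, hp, h, rfl⟩ x hx v hv
  obtain ⟨s, t, rfl⟩ := Submodule.mem_span_pair.1 (hx hv)
  rw [← eval_aeval_smul_add_smul]
  exact hp _ (hQ (aeval_mem_fanoIdeal F s t))

theorem affVanishing_mem_minimalPrimes [IsAlgClosed K] {N : ℕ} {F : MvPolynomial (Fin (N + 1)) K}
    {S : Set (Grass K 2 N)} (hS : IsGrComponentOf K S (fanoSet K F)) :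
    affVanishing K (frameCone K 2 N S) ∈ (fanoIdeal K F).minimalPrimes := by
  have : Infinite K := IsAlgClosed.instInfinite
  obtain ⟨hsub, hirr, hmax⟩ := hS
  have := isPrime_affVanishing_frameCone hirr
  obtain ⟨Q, hQ, hQP⟩ := Ideal.exists_minimalPrimes_le (fanoIdeal_le_affVanishing hsub)
  have : Q.IsPrime := hQ.1.1
  have hle : S ⊆ linesOfIdeal Q := by
    intro W hW
    obtain ⟨p, hp, h⟩ := exists_frame W
    exact ⟨p, fun f hf => mem_affVanishing_frameCone.1 (hQP hf) W hW p hp, h,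
      Subtype.ext (span_pair_eq h (hp 0) (hp 1))⟩
  have heq := hmax _ hle (linesOfIdeal_subset_fanoSet hQ.1.2)
    (grIrred_linesOfIdeal Q (hirr.1.mono hle))
  obtain ⟨W, hW⟩ := hirr.1
  obtain ⟨p, hp, h, rfl⟩ := hle hW
  obtain ⟨a, b, hab⟩ := exists_minor_ne_zero h
  have hm : frameMinor a b ∉ Q := fun hmem => hab (by rw [← eval_frameMinor, hp _ hmem])
  suffices affVanishing K (frameCone K 2 N S) ≤ Q by rwa [le_antisymm this hQP]
  intro f hf
  by_contra hfQ
  have hprod : f * frameMinor a b ∉ Q := fun hmem =>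
    (Ideal.IsPrime.mem_or_mem ‹_› hmem).elim hfQ hm
  obtain ⟨q, hq, hq'⟩ := exists_eval_ne_zero_of_notMem hprod
  rw [map_mul, eval_frameMinor] at hq'
  have hli := linearIndependent_of_minor_ne_zero (x := fun j => q (0, j)) (y := fun j => q (1, j))
    (right_ne_zero_of_mul hq')
  refine left_ne_zero_of_mul hq' (mem_affVanishing_frameCone.1 hf (lineOfFrame q hli) ?_ q
    (frameMem_lineOfFrame q hli))
  rw [← heq]
  exact ⟨q, hq, hli, rfl⟩

theorem aeval_inl_add_inr {σ L : Type} [Fintype σ] [Field L] [Algebra K L] (u c : σ → L)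
    (F : MvPolynomial σ K) :
    aeval (fun j => (TrivSqZeroExt.inl (u j) + TrivSqZeroExt.inr (c j) : DualNumber L)) F =
      TrivSqZeroExt.inl (aeval u F) + TrivSqZeroExt.inr (∑ j, aeval u (pderiv j F) * c j) := by
  classical
  induction F using MvPolynomial.induction_on with
  | C a => ext <;> simp [TrivSqZeroExt.algebraMap_eq_inl']
  | add f g hf hg =>
    rw [map_add, hf, hg]
    ext <;> simp [add_mul, Finset.sum_add_distrib]
  | mul_X f i hf =>
    rw [map_mul, hf]
    have : ∀ j, aeval u (pderiv j (f * X i)) * c j = u i * (aeval u (pderiv j f) * c j) +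
        if j = i then aeval u f * c j else 0 := by
      intro j
      split_ifs with hj
      · subst hj
        simp [Derivation.leibniz]
        ring
      · simp [Derivation.leibniz, pderiv_X, hj]
        ring
    simp only [this, Finset.sum_add_distrib, ← Finset.mul_sum, Finset.sum_ite_eq',
      Finset.mem_univ, if_true]
    ext <;> simp [mul_comm]

theorem exists_derivation_of_dualNumber {A L : Type} [CommRing A] [IsDomain A] [Algebra K A]
    [Field L] [Algebra K L] [Algebra A L] [IsScalarTower K A L] [IsFractionRing A L]
    (φ : A →ₐ[K] DualNumber L) (hφ : ∀ x, (φ x).fst = algebraMap A L x) :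
    ∃ D : Derivation K L L, ∀ x, D (algebraMap A L x) = (φ x).snd := by
  have hu : ∀ y : nonZeroDivisors A, IsUnit (φ y) := fun y => by
    rw [TrivSqZeroExt.isUnit_iff_isUnit_fst, hφ]
    exact IsLocalization.map_units L y
  let Λ : L →ₐ[K] DualNumber L := IsLocalization.liftAlgHom hu
  have hΛ : ∀ x, Λ (algebraMap A L x) = φ x := fun x => IsLocalization.lift_eq hu x
  have hfst : ∀ x, (Λ x).fst = x := by
    have : (TrivSqZeroExt.fstHom K L L).comp Λ = AlgHom.id K L := by
      apply IsLocalization.algHom_ext (nonZeroDivisors A)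
      ext x
      change (Λ (algebraMap A L x)).fst = algebraMap A L x
      rw [hΛ, hφ]
    exact fun x => congrArg (fun f => f x) this
  refine ⟨Derivation.mk' ((TrivSqZeroExt.sndHom L L).restrictScalars K ∘ₗ Λ.toLinearMap) ?_, ?_⟩
  · intro x y
    simp [hfst, mul_comm]
  · intro x
    simp [hΛ]

theorem exists_derivation_of_tangent [Infinite K] {N : ℕ} {F : MvPolynomial (Fin (N + 1)) K}
    {P : Ideal (MvPolynomial (Fin 2 × Fin (N + 1)) K)} [P.IsPrime] (hP : fanoIdeal K F ≤ P)
    (hred : ∀ x ∈ P, ∃ s, s ∉ P ∧ s * x ∈ fanoIdeal K F) {L : Type} [Field L] [Algebra K L]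
    [Algebra (MvPolynomial (Fin 2 × Fin (N + 1)) K ⧸ P) L]
    [IsScalarTower K (MvPolynomial (Fin 2 × Fin (N + 1)) K ⧸ P) L]
    [IsFractionRing (MvPolynomial (Fin 2 × Fin (N + 1)) K ⧸ P) L]
    {u : Fin 2 × Fin (N + 1) → L}
    (hu : ∀ i, u i = algebraMap _ L (Ideal.Quotient.mk P (X i))) {e : Fin (N + 1) → L}
    (he : ∀ s t : K, ∑ j, aeval (fun j => s • u (0, j) + t • u (1, j)) (pderiv j F) * e j = 0) :
    ∃ D : Derivation K L L, (∀ j, D (u (0, j)) = 0) ∧ ∀ j, D (u (1, j)) = e j := by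
  let φ : MvPolynomial (Fin 2 × Fin (N + 1)) K →ₐ[K] DualNumber L :=
    aeval fun i => TrivSqZeroExt.inl (u i) + TrivSqZeroExt.inr (if i.1 = 0 then 0 else e i.2)
  have hfst : ∀ x, (φ x).fst = algebraMap _ L (Ideal.Quotient.mk P x) := by
    have : (TrivSqZeroExt.fstHom K L L).comp φ =
        (IsScalarTower.toAlgHom K (MvPolynomial (Fin 2 × Fin (N + 1)) K ⧸ P) L).comp
          (Ideal.Quotient.mkₐ K P) := by
      ext i
      by_cases hi : i.1 = 0 <;> simp [φ, hu, hi]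
    exact fun x => congrArg (fun f => f x) this
  have hφe : ∀ s t : K, φ (aeval (fun j : Fin (N + 1) =>
      s • (X (0, j) : MvPolynomial (Fin 2 × Fin (N + 1)) K) + t • X (1, j)) F) = 0 := by
    intro s t
    have h1 : φ (aeval (fun j : Fin (N + 1) =>
        s • (X (0, j) : MvPolynomial (Fin 2 × Fin (N + 1)) K) + t • X (1, j)) F) =
        aeval (fun j => (TrivSqZeroExt.inl (s • u (0, j) + t • u (1, j)) +
          TrivSqZeroExt.inr (t • e j) : DualNumber L)) F := by
      rw [← AlgHom.comp_apply, comp_aeval]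
      congr 2
      ext j <;> simp [φ]
    ext
    · rw [hfst, Ideal.Quotient.eq_zero_iff_mem.2 (hP (aeval_mem_fanoIdeal F s t))]
      simp
    · rw [h1, aeval_inl_add_inr]
      simp [he s t, ← Finset.smul_sum]
  have hφI : fanoIdeal K F ≤ RingHom.ker φ := by
    refine Ideal.span_le.2 ?_
    rintro _ ⟨d, rfl⟩
    refine TrivSqZeroExt.ext ?_ ?_
    · exact linearMap_eq_zero_of_mem_fanoIdeal
        ((TrivSqZeroExt.fstHom K L L).toLinearMap ∘ₗ φ.toLinearMap)
        (fun s t => congrArg TrivSqZeroExt.fst (hφe s t)) d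
    · exact linearMap_eq_zero_of_mem_fanoIdeal
        ((TrivSqZeroExt.sndHom L L).restrictScalars K ∘ₗ φ.toLinearMap)
        (fun s t => congrArg TrivSqZeroExt.snd (hφe s t)) d
  have hφP : ∀ x ∈ P, φ x = 0 := by
    intro x hx
    obtain ⟨s, hs, hsx⟩ := hred x hx
    have h0 : φ s * φ x = 0 := by rw [← map_mul]; exact hφI hsx
    have hsu : IsUnit (φ s) := by
      rw [TrivSqZeroExt.isUnit_iff_isUnit_fst, hfst, isUnit_iff_ne_zero]
      intro h
      exact hs (Ideal.Quotient.eq_zero_iff_mem.1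
        ((IsFractionRing.injective _ L) (h.trans (map_zero _).symm)))
    exact (hsu.mul_right_eq_zero).1 h0
  obtain ⟨D, hD⟩ := exists_derivation_of_dualNumber (L := L) (Ideal.Quotient.liftₐ P φ hφP) (by
    intro x
    obtain ⟨x, rfl⟩ := Ideal.Quotient.mk_surjective x
    exact hfst x)
  have hDX : ∀ i, D (u i) = (φ (X i)).snd := fun i => by
    rw [hu, hD]
    rfl
  refine ⟨D, fun j => ?_, fun j => ?_⟩
  · rw [hDX]
    simp [φ]
  · rw [hDX]
    simp [φ]

theorem eval_smul_of_isHomogeneous {σ : Type} {n : ℕ} {F : MvPolynomial σ K}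
    (hF : F.IsHomogeneous n) (c : K) (u : σ → K) : eval (c • u) F = c ^ n * eval u F := by
  rw [eval_eq, eval_eq, Finset.mul_sum]
  refine Finset.sum_congr rfl fun d hd => ?_
  have hdn : ∑ i ∈ d.support, d i = n := by
    by_contra h
    exact mem_support_iff.1 hd (hF.coeff_eq_zero h)
  simp only [Pi.smul_apply, smul_eq_mul, mul_pow, Finset.prod_mul_distrib,
    Finset.prod_pow_eq_pow_sum, hdn]
  ring

theorem dvd_of_forall_mem_family [IsAlgClosed K] {N n : ℕ} {F : MvPolynomial (Fin (N + 1)) K}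
    (hdeg : F.IsHomogeneous n) (hIrr : Irreducible F) {S : Set (Grass K 2 N)} {μ : ℕ}
    (hμ : HasMuOn K S F μ) (hμ0 : μ ≠ 0) {f : MvPolynomial (Fin (N + 1)) K}
    (hf : ∀ W ∈ S, ∀ u ∈ W.1, eval u f = 0) : F ∣ f := by
  obtain ⟨G, ⟨x₀, hx₀, v₀, hv₀, hG₀⟩, hG⟩ := hμ
  have hne : ∀ x ∈ projZeros K F, (∃ v ∈ x.submodule, eval v G ≠ 0) →
      ∃ W ∈ S, x ∈ projLinear K W.1 := by
    intro x hx hv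
    have h : {W | W ∈ S ∧ x ∈ projLinear K W.1}.ncard = μ := hG x hx hv
    obtain ⟨W, hW⟩ := Set.nonempty_of_ncard_ne_zero (h.trans_ne hμ0)
    exact ⟨W, hW⟩
  have hvan : ∀ u, eval u F = 0 → eval u (f * G) = 0 := by
    intro u hu
    rw [map_mul, mul_eq_zero, or_iff_not_imp_right]
    intro hGu
    by_cases hu0 : u = 0
    · obtain ⟨W, hW, -⟩ := hne x₀ hx₀ ⟨v₀, hv₀, hG₀⟩
      exact hf W hW u (hu0 ▸ W.1.zero_mem)
    · have hmem : u ∈ (Projectivization.mk K u hu0).submodule := by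
        rw [Projectivization.submodule_mk]
        exact Submodule.mem_span_singleton_self u
      obtain ⟨W, hW, hWx⟩ := hne (Projectivization.mk K u hu0) (by
        intro w hw
        rw [Projectivization.submodule_mk, Submodule.mem_span_singleton] at hw
        obtain ⟨c, rfl⟩ := hw
        rw [eval_smul_of_isHomogeneous hdeg, hu, mul_zero]) ⟨u, hmem, hGu⟩
      exact hf W hW u (hWx hmem)
  have hprime : Prime F := hIrr.prime
  have hP : (Ideal.span {F}).IsPrime := (Ideal.span_singleton_prime hprime.ne_zero).2 hprime
  have hdvd : F ∣ f * G := by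
    rw [← Ideal.mem_span_singleton]
    by_contra hcon
    obtain ⟨p, hp, hpf⟩ := exists_eval_ne_zero_of_notMem hcon
    exact hpf (hvan p (hp F (Ideal.mem_span_singleton_self F)))
  refine (hprime.dvd_or_dvd hdvd).resolve_right ?_
  rintro ⟨h, rfl⟩
  exact hG₀ (by rw [map_mul, hx₀ v₀ hv₀, zero_mul])

theorem exists_degreeOf_ne_zero {σ : Type} [Finite σ] {F : MvPolynomial σ K} (hIrr : Irreducible F) :
    ∃ i, degreeOf i F ≠ 0 := by
  by_contra! h
  have hC : F = C (coeff 0 F) := by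
    rw [← totalDegree_eq_zero_iff_eq_C]
    rw [totalDegree_eq_zero_iff]
    intro m hm x
    have := degreeOf_le_iff.1 (h x).le m hm
    omega
  refine hIrr.not_isUnit ?_
  rw [hC]
  refine (IsUnit.mk0 _ fun h0 => hIrr.ne_zero ?_).map C
  rw [hC, h0, C_0]

theorem eq_zero_of_dvd_rename {σ : Type} {F : MvPolynomial σ K} {i : σ}
    (hi : degreeOf i F ≠ 0) {g : MvPolynomial {j // j ≠ i} K} (h : F ∣ rename Subtype.val g) :
    g = 0 := by
  classical
  obtain ⟨k, hk⟩ := h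
  by_contra hg
  have hne : rename Subtype.val g ≠ 0 := fun h0 =>
    hg (rename_injective _ Subtype.val_injective (h0.trans (map_zero _).symm))
  have h1 : degreeOf i (rename (Subtype.val : {j // j ≠ i} → σ) g) = 0 := by
    by_contra hcon
    obtain ⟨j, -, hj⟩ := Finset.mem_image.1
      (vars_rename _ _ (mem_vars_iff_degreeOf_ne_zero.2 hcon))
    exact j.2 hj
  rw [hk] at hne
  rw [hk, degreeOf_mul_eq (left_ne_zero_of_mul hne) (right_ne_zero_of_mul hne)] at h1
  omega

theorem exists_pair_of_ncard_le_two {ι L : Type} [Fintype ι] (hι : 2 ≤ Fintype.card ι) {w : ι → L}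
    {T : Set L} (hT : T ⊆ Set.range w) (hfin : T.Finite) (hcard : T.ncard ≤ 2) :
    ∃ a b, a ≠ b ∧ ∀ x ∈ T, x = w a ∨ x = w b := by
  classical
  have hex : ∀ x : T, ∃ i, w i = x := fun x => hT x.2
  choose g hg using hex
  have := hfin.fintype
  obtain ⟨I, hI, hI2⟩ := Finset.exists_superset_card_eq (s := Finset.univ.image g) (n := 2)
    (Finset.card_image_le.trans (by
      rwa [Finset.card_univ, ← Nat.card_eq_fintype_card, Nat.card_coe_set_eq])) hι
  obtain ⟨a, b, hab, rfl⟩ := Finset.card_eq_two.1 hI2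
  refine ⟨a, b, hab, fun x hx => ?_⟩
  have h1 := hI (Finset.mem_image_of_mem g (Finset.mem_univ ⟨x, hx⟩))
  have h2 := hg ⟨x, hx⟩
  rw [Finset.mem_insert, Finset.mem_singleton] at h1
  exact h1.imp (fun h => by rw [← h, h2]) (fun h => by rw [← h, h2])

theorem exists_determining_pair [CharZero K] {N : ℕ} {L : Type} [Field L] [Algebra K L]
    (u : Fin 2 × Fin (N + 2) → L) [Algebra.IsAlgebraic (Algebra.adjoin K (Set.range u)) L]
    {i : Fin (N + 2)}
    (hi : AlgebraicIndependent K fun j : {j // j ≠ i} => u (0, j.1))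
    (htr : Algebra.trdeg K L ≤ (N + 3 : ℕ)) :
    ∃ a b, a ≠ b ∧ ∀ D : Derivation K L L, (∀ j, D (u (0, j)) = 0) →
      D (u (1, a)) = 0 → D (u (1, b)) = 0 → D = 0 := by
  classical
  obtain ⟨B, hsB, hBt, hB⟩ := exists_isTranscendenceBasis_between
    (Set.range fun j : {j // j ≠ i} => u (0, j.1)) (Set.range u)
    (by rintro _ ⟨j, rfl⟩; exact ⟨_, rfl⟩) hi.coe_range
  have hBcard : Cardinal.mk B ≤ (N + 3 : ℕ) := hB.cardinalMk_eq_trdeg.trans_le htr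
  have hBfin : B.Finite :=
    Cardinal.lt_aleph0_iff_set_finite.1 (hBcard.trans_lt (Cardinal.natCast_lt_aleph0))
  have hBn : B.ncard ≤ N + 3 := by
    rw [← Set.cast_ncard hBfin] at hBcard
    exact_mod_cast hBcard
  set s := Set.range fun j : {j // j ≠ i} => u (0, j.1) with hs
  have hsn : s.ncard = N + 1 := by
    rw [hs, ← Set.image_univ, Set.ncard_image_of_injective _ hi.injective, Set.ncard_univ]
    simp
  set T := B \ Set.range fun j => u (0, j) with hT
  have hTn : T.ncard ≤ 2 := by
    have h1 : T ⊆ B \ s := by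
      refine Set.sdiff_subset_sdiff_right ?_
      rintro _ ⟨j, rfl⟩
      exact ⟨_, rfl⟩
    have h2 := Set.ncard_le_ncard h1 (hBfin.sdiff)
    have h3 := Set.ncard_sdiff_add_ncard_of_subset hsB hBfin
    omega
  obtain ⟨a, b, hab, h⟩ := exists_pair_of_ncard_le_two (w := fun j => u (1, j)) (by simp)
    (T := T) (by
      rintro x ⟨hxB, hx⟩
      obtain ⟨⟨k, j⟩, rfl⟩ := hBt hxB
      fin_cases k
      · exact absurd ⟨j, rfl⟩ hx
      · exact ⟨j, rfl⟩) hBfin.sdiff hTn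
  refine ⟨a, b, hab, fun D hD ha hb => derivation_eq_zero_of_isTranscendenceBasis B hB D ?_⟩
  intro x hx
  by_cases hxv : x ∈ Set.range fun j => u (0, j)
  · obtain ⟨j, rfl⟩ := hxv
    exact hD j
  · rcases h x ⟨hx, hxv⟩ with rfl | rfl
    exacts [ha, hb]

section

variable {L : Type} [Field L]

theorem exists_notMem_span_of_separating {ι : Type} {c : ι → Fin 5 → L} {a b : Fin 5}
    (hc : ∀ e : Fin 5 → L, e a = 0 → e b = 0 → (∀ i, ∑ j, c i j * e j = 0) → e = 0)
    {m : ℕ} (hm : m < 5) {u : Fin m → Fin 5 → L}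
    (ha : Pi.single a 1 ∈ Set.range u) (hb : Pi.single b 1 ∈ Set.range u) :
    ∃ i, c i ∉ Submodule.span L (Set.range u) := by
  by_contra! h
  obtain ⟨e, he, hne⟩ := Submodule.exists_mem_ne_zero_of_ne_bot
    (LinearMap.ker_ne_bot_of_finrank_lt (f := Matrix.mulVecLin (Matrix.of u)) (by simpa using hm))
  rw [LinearMap.mem_ker, Matrix.mulVecLin_apply] at he
  have hz : ∀ x ∈ Submodule.span L (Set.range u), ∑ j, x j * e j = 0 := by
    intro x hx
    induction hx using Submodule.span_induction with
    | mem x hx => obtain ⟨k, rfl⟩ := hx; exact congrFun he k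
    | zero => simp
    | add x y _ _ hx hy => simp [add_mul, Finset.sum_add_distrib, hx, hy]
    | smul r x _ hx => simp [mul_assoc, ← Finset.mul_sum, hx]
  have hsingle : ∀ k, Pi.single k 1 ∈ Set.range u → e k = 0 := fun k hk => by
    simpa [Pi.single_apply] using hz _ (Submodule.subset_span hk)
  exact hne (hc e (hsingle a ha) (hsingle b hb) fun i => hz _ (h i))

theorem exists_det_ne_zero_of_separating {ι : Type} {c : ι → Fin 5 → L} {a b : Fin 5} (hab : a ≠ b)
    (hc : ∀ e : Fin 5 → L, e a = 0 → e b = 0 → (∀ i, ∑ j, c i j * e j = 0) → e = 0) :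
    ∃ i : Fin 3 → ι,
      (Matrix.of ![c (i 0), c (i 1), c (i 2), Pi.single a 1, Pi.single b 1]).det ≠ 0 := by
  have h0 : LinearIndependent L ![(Pi.single a 1 : Fin 5 → L), Pi.single b 1] := by
    rw [LinearIndependent.pair_iff]
    intro s t hst
    have h1 := congrFun hst a
    have h2 := congrFun hst b
    simp [hab, hab.symm] at h1 h2
    exact ⟨h1, h2⟩
  obtain ⟨i₂, h₂⟩ := exists_notMem_span_of_separating hc (by norm_num)
    (u := ![Pi.single a 1, Pi.single b 1]) ⟨0, rfl⟩ ⟨1, rfl⟩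
  have h1 := linearIndependent_finCons.2 ⟨h0, h₂⟩
  obtain ⟨i₁, h₁⟩ := exists_notMem_span_of_separating hc (by norm_num)
    (u := Fin.cons (c i₂) ![Pi.single a 1, Pi.single b 1]) ⟨1, rfl⟩ ⟨2, rfl⟩
  have h2 := linearIndependent_finCons.2 ⟨h1, h₁⟩
  obtain ⟨i₀, h₀⟩ := exists_notMem_span_of_separating hc (by norm_num)
    (u := Fin.cons (c i₁) (Fin.cons (c i₂) ![Pi.single a 1, Pi.single b 1])) ⟨2, rfl⟩ ⟨3, rfl⟩
  have h3 := linearIndependent_finCons.2 ⟨h2, h₀⟩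
  refine ⟨![i₀, i₁, i₂], ?_⟩
  rw [← isUnit_iff_ne_zero, ← Matrix.isUnit_iff_isUnit_det,
    ← Matrix.linearIndependent_rows_iff_isUnit]
  exact h3

end

theorem algebraicIndependent_of_forall_mem_family [IsAlgClosed K] {N n : ℕ}
    {F : MvPolynomial (Fin (N + 1)) K}
    (hdeg : F.IsHomogeneous n) (hIrr : Irreducible F) {S : Set (Grass K 2 N)} {μ : ℕ}
    (hμ : HasMuOn K S F μ) (hμ0 : μ ≠ 0) {i : Fin (N + 1)} (hi : degreeOf i F ≠ 0)
    {L : Type} [Field L] [Algebra K L] {u : Fin 2 × Fin (N + 1) → L}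
    (hu : ∀ f, aeval u f = 0 → f ∈ affVanishing K (frameCone K 2 N S)) :
    AlgebraicIndependent K fun j : {j // j ≠ i} => u (0, j.1) := by
  rw [algebraicIndependent_iff]
  intro g hg
  refine eq_zero_of_dvd_rename hi
    (dvd_of_forall_mem_family hdeg hIrr hμ hμ0 fun W hW v hv => ?_)
  have h := mem_affVanishing_frameCone.1 (hu (rename (fun j => (0, j)) (rename Subtype.val g))
    (by rw [rename_rename, aeval_rename]; exact hg)) W hW (fun k => v k.2) fun _ => hv
  rw [eval_rename] at h
  exact h

theorem exists_det_gradient_ne_zero [IsAlgClosed K] [CharZero K]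
    {n : ℕ} {F : MvPolynomial (Fin 5) K}
    (hdeg : F.IsHomogeneous n) (hIrr : Irreducible F) (hred : FanoGenerallyReduced K F)
    {S : Set (Grass K 2 4)} (hS : IsGrComponentOf K S (fanoSet K F)) (hd : HasGrDim K S 2)
    {μ : ℕ} (hμ : HasMuOn K S F μ) (hμ0 : μ ≠ 0) :
    ∃ (s t : Fin 3 → K) (a b : Fin 5),
      let c (k : Fin 3) (j : Fin 5) : MvPolynomial (Fin 2 × Fin 5) K :=
        aeval (fun l => s k • X (0, l) + t k • X (1, l)) (pderiv j F)
      (Matrix.of ![c 0, c 1, c 2, Pi.single a 1, Pi.single b 1]).det ∉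
        affVanishing K (frameCone K 2 4 S) := by
  have := IsAlgClosed.instInfinite (K := K)
  set P := affVanishing K (frameCone K 2 4 S)
  have hP : P.IsPrime := isPrime_affVanishing_frameCone hS.2.1
  let A := MvPolynomial (Fin 2 × Fin 5) K ⧸ P
  let L := FractionRing A
  let φ : MvPolynomial (Fin 2 × Fin 5) K →ₐ[K] L :=
    (IsScalarTower.toAlgHom K A L).comp (Ideal.Quotient.mkₐ K P)
  have hφ : ∀ f, φ f = 0 ↔ f ∈ P := by
    intro f
    change algebraMap A L (Ideal.Quotient.mk P f) = 0 ↔ _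
    rw [FaithfulSMul.algebraMap_eq_zero_iff, Ideal.Quotient.eq_zero_iff_mem]
  let u : Fin 2 × Fin 5 → L := fun k => φ (X k)
  have hφu : ∀ f, φ f = aeval u f := fun f => by
    rw [show φ = aeval u from algHom_ext fun k => by rw [aeval_X]]
  have htr : Algebra.trdeg K L ≤ (3 + 3 : ℕ) := trdeg_fractionRing_le_of_ringKrullDim_eq hd
  have halg : Algebra.IsAlgebraic (Algebra.adjoin K (Set.range u)) L := by
    have hA : ∀ x : A, IsAlgebraic (Algebra.adjoin K (Set.range u)) (algebraMap A L x) := by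
      intro x
      obtain ⟨f, rfl⟩ := Ideal.Quotient.mk_surjective x
      have hf : φ f ∈ Algebra.adjoin K (Set.range u) := by
        rw [hφu, Algebra.adjoin_range_eq_range_aeval]
        exact ⟨f, rfl⟩
      exact isAlgebraic_algebraMap (⟨φ f, hf⟩ : Algebra.adjoin K (Set.range u))
    refine ⟨fun x => ?_⟩
    obtain ⟨y, z, -, rfl⟩ := IsFractionRing.div_surjective (A := A) x
    rw [div_eq_mul_inv]
    exact (hA y).mul (hA z).inv
  obtain ⟨i, hi⟩ := exists_degreeOf_ne_zero hIrr
  have hind := algebraicIndependent_of_forall_mem_family hdeg hIrr hμ hμ0 hi (u := u)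
    fun f hf => (hφ f).1 ((hφu f).trans hf)
  obtain ⟨a, b, hab, hD⟩ := exists_determining_pair u hind htr
  obtain ⟨k, hk⟩ := exists_det_ne_zero_of_separating hab
    (c := fun (k : K × K) j => aeval (fun l => k.1 • u (0, l) + k.2 • u (1, l)) (pderiv j F)) (by
      intro e ha hb he
      obtain ⟨D, hD0, hD1⟩ := exists_derivation_of_tangent (fanoIdeal_le_affVanishing hS.1)
        (hred P (affVanishing_mem_minimalPrimes hS)) (L := L) (u := u) (fun _ => rfl) (e := e)
        fun s t => he (s, t)
      have h0 := hD D hD0 (by rw [hD1, ha]) (by rw [hD1, hb])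
      ext j
      rw [← hD1, h0]
      rfl)
  refine ⟨fun j => (k j).1, fun j => (k j).2, a, b, ?_⟩
  intro c hcon
  refine hk ?_
  rw [← (hφ _).2 hcon, AlgHom.map_det]
  congr 1
  have hc : ∀ l j, φ (c l j) = aeval (fun m => (k l).1 • u (0, m) + (k l).2 • u (1, m))
      (pderiv j F) := by
    intro l j
    refine (comp_aeval_apply (f := fun m => (k l).1 • X (0, m) + (k l).2 • X (1, m)) φ _).trans ?_
    simp only [map_add, map_smul]
    rfl
  have hs : ∀ a j : Fin 5, (Pi.single a 1 : Fin 5 → L) j =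
      φ ((Pi.single a 1 : Fin 5 → MvPolynomial (Fin 2 × Fin 5) K) j) := by
    intro a j
    rw [Pi.single_apply, Pi.single_apply]
    split_ifs <;> simp
  ext l j
  fin_cases l
  exacts [(hc 0 j).symm, (hc 1 j).symm, (hc 2 j).symm, hs a j, hs b j]

theorem eval_det_gradient {F : MvPolynomial (Fin 5) K} (s t : Fin 3 → K) (a b : Fin 5)
    (p : Fin 2 × Fin 5 → K) :
    let c (k : Fin 3) (j : Fin 5) : MvPolynomial (Fin 2 × Fin 5) K :=
      aeval (fun l => s k • X (0, l) + t k • X (1, l)) (pderiv j F)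
    let q (k : Fin 3) : Fin 5 → K := s k • (fun j => p (0, j)) + t k • fun j => p (1, j)
    eval p (Matrix.of ![c 0, c 1, c 2, Pi.single a 1, Pi.single b 1]).det =
      (Matrix.of ![gradVec K F (q 0), gradVec K F (q 1), gradVec K F (q 2),
        Pi.single a 1, Pi.single b 1]).det := by
  intro c q
  rw [RingHom.map_det]
  congr 1
  have hs : ∀ a j : Fin 5, eval p ((Pi.single a 1 : Fin 5 → MvPolynomial (Fin 2 × Fin 5) K) j) =
      (Pi.single a 1 : Fin 5 → K) j := by
    intro a j
    rw [Pi.single_apply, Pi.single_apply]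
    split_ifs <;> simp
  ext l j
  fin_cases l
  exacts [eval_aeval_smul_add_smul _ _ _ _, eval_aeval_smul_add_smul _ _ _ _,
    eval_aeval_smul_add_smul _ _ _ _, hs a j, hs b j]

/-- let `Fam` be an irreducible two-dimensional component of the (generically
reduced) Fano scheme with `μ₁ > 1`, and for `r ∈ Fam` let `σ₁(r)` be the family of lines of
`Fam` meeting `r`.  Then a general `r ∈ Fam` does not lie in (the closure of) `σ₁(r)`,
i.e. `r` is not a limit of lines of `Fam` meeting `r`. -/
theorem general_line_not_in_sigma_of_itself
    (K : Type) [Field K] [IsAlgClosed K] [CharZero K]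
    (n : ℕ) (F : MvPolynomial (Fin 5) K)
    (hdeg : F.IsHomogeneous n) (hIrr : Irreducible F)
    (hcov : CoveredByLines K F) (hdim : HasGrDim K (fanoSet K F) 2)
    (hred : FanoGenerallyReduced K F)
    (Fam : Set (Grass K 2 4)) (hcomp : IsGrComponentOf K Fam (fanoSet K F))
    (hd1 : HasGrDim K Fam 2)
    (μ₁ : ℕ) (hμ : HasMuOn K Fam F μ₁) (hμ1 : 1 < μ₁) :
    GenerallyOnGr K Fam (fun r =>
      r ∉ grClosure K {r' | r' ∈ Fam ∧ r' ≠ r ∧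
        (projLinear K r'.1 ∩ projLinear K r.1).Nonempty}) := by
  have := IsAlgClosed.instInfinite (K := K)
  obtain ⟨s, t, a, b, hdet⟩ :=
    exists_det_gradient_ne_zero hdeg hIrr hred hcomp hd1 hμ (by omega : μ₁ ≠ 0)
  dsimp only at hdet
  rw [mem_affVanishing_frameCone] at hdet
  push Not at hdet
  refine ⟨_, hdet, fun r hr h => ?_⟩
  obtain ⟨p, hp, hpG⟩ := h
  rw [eval_det_gradient] at hpG
  exact notMem_grClosure_of_det_ne_zero (hcomp.1 hr) (fun r' hr' => ⟨hcomp.1 hr'.1, hr'.2⟩)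
    (fun k => r.1.add_mem (r.1.smul_mem (s k) (hp 0)) (r.1.smul_mem (t k) (hp 1))) hpG

end PaperLines
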